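/- Assume every irreducible component of C has degree at least 2, i.e., d_i ≥ 2 for all i = 1,…,k. Let l₀ ∈ T_C be a line meeting C transversally and let τ be any permutation of the d-element set C ∩ l₀ such that τ maps C_i ∩ l₀ onto C_i ∩ l₀ for each i. Then there exist a loop γ : [0,1] → T_C with γ(0) = γ(1) = l₀ and, for each point P ∈ C ∩ l₀, a continuous map ψ_P : [0,1] → ℙ² with ψ_P(0) = P and ψ_P(t) ∈ C ∩ γ(t) for all t, such that for every t ∈ [0,1] the points ψ_P(t), P ∈ C ∩ l₀, are pairwise distinct and ψ_P(1) = τ(P) for every P ∈ C ∩ l₀. Combined with the fact that every such monodromy permutation preserves each set C_i ∩ l₀, this says the monodromy group of the family of transversal line sections of C is the direct product Σ_{d₁} × … × Σ_{d_k} of the symmetric groups on the sets C_i ∩ l₀. -/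

import Mathlib

open MvPolynomial

noncomputable section

/-- The complex projective plane `ℙ²(ℂ)` (also used as its own dual `ℙ̂²`). -/
abbrev P2 : Type := Projectivization ℂ (Fin 3 → ℂ)

/-- The classical (Euclidean) topology on `ℙ²(ℂ)`: the quotient topology from
`ℂ³ \ {0}`. -/
instance : TopologicalSpace P2 :=
  inferInstanceAs (TopologicalSpace (Quotient (projectivizationSetoid ℂ (Fin 3 → ℂ))))

/-- The line in `ℙ²` corresponding to a point `ξ` of the dual plane `ℙ̂²`:
the zero locus of the linear form with coefficient vector `ξ`. -/
def lineSet (ξ : P2) : Set P2 := {x | ∑ i, ξ.rep i * x.rep i = 0}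

/-- The plane curve `{F = 0} ⊂ ℙ²` defined by a homogeneous polynomial `F`. -/
def curveSet (F : MvPolynomial (Fin 3) ℂ) : Set P2 := {x | eval x.rep F = 0}

/-- `T_C`: the set of (points of `ℙ̂²` corresponding to) lines meeting the degree `d`
curve `C = {F = 0}` transversally, i.e. in exactly `d` distinct points. -/
def transversalLines (F : MvPolynomial (Fin 3) ℂ) (d : ℕ) : Set P2 :=
  {ξ | (curveSet F ∩ lineSet ξ).ncard = d}

open scoped ContDiff Topology

/-- `Monodromy S T b b' σ`: there is a path in `T` from `b` to `b'` along which the points of the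
fibre `S b` move continuously inside the fibres of `S`, staying pairwise distinct, in such a way
that `x` ends at `σ x`. -/
def Monodromy {B X : Type*} [TopologicalSpace B] [TopologicalSpace X] (S : B → Set X) (T : Set B)
    (b b' : B) (σ : X → X) : Prop :=
  ∃ γ : Path b b', (∀ t, γ t ∈ T) ∧ ∃ ψ : X → unitInterval → X,
    (∀ x ∈ S b, Continuous (ψ x) ∧ ψ x 0 = x ∧ ψ x 1 = σ x ∧ ∀ t, ψ x t ∈ S (γ t)) ∧
    ∀ t, Set.InjOn (fun x => ψ x t) (S b)

namespace Monodromy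

variable {B X : Type*} [TopologicalSpace B] [TopologicalSpace X] {S : B → Set X} {T : Set B}
  {b b' b'' : B} {σ σ' : X → X}

theorem mapsTo (h : Monodromy S T b b' σ) : Set.MapsTo σ (S b) (S b') := by
  obtain ⟨γ, -, ψ, hψ, -⟩ := h
  intro x hx
  obtain ⟨-, -, h1, h2⟩ := hψ x hx
  simpa [h1] using h2 1

theorem injOn (h : Monodromy S T b b' σ) : Set.InjOn σ (S b) := by
  obtain ⟨γ, -, ψ, hψ, hinj⟩ := h
  intro x hx y hy hxy
  refine hinj 1 hx hy ?_
  simpa [(hψ x hx).2.2.1, (hψ y hy).2.2.1] using hxy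

theorem bijOn (h : Monodromy S T b b' σ) (hb' : (S b').Finite)
    (hcard : (S b').ncard ≤ (S b).ncard) : Set.BijOn σ (S b) (S b') := by
  refine ⟨h.mapsTo, h.injOn, ?_⟩
  have him : σ '' S b ⊆ S b' := h.mapsTo.image_subset
  have : σ '' S b = S b' :=
    Set.eq_of_subset_of_ncard_le him (by rwa [h.injOn.ncard_image]) hb'
  exact this.symm.subset

theorem congr (h : Monodromy S T b b' σ) (hσ : Set.EqOn σ σ' (S b)) :
    Monodromy S T b b' σ' := by
  obtain ⟨γ, hγ, ψ, hψ, hinj⟩ := h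
  refine ⟨γ, hγ, ψ, fun x hx => ?_, hinj⟩
  obtain ⟨h1, h2, h3, h4⟩ := hψ x hx
  exact ⟨h1, h2, h3.trans (hσ hx), h4⟩

theorem refl (hb : b ∈ T) : Monodromy S T b b id :=
  ⟨Path.refl b, fun _ => hb, fun x _ => x, fun _ hx => ⟨continuous_const, rfl, rfl, fun _ => hx⟩,
    fun _ => Set.injOn_id _⟩

theorem trans (h : Monodromy S T b b' σ) (h' : Monodromy S T b' b'' σ') :
    Monodromy S T b b'' (σ' ∘ σ) := by
  have hm := h.mapsTo
  have hi := h.injOn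
  obtain ⟨γ, hγ, ψ, hψ, hinj⟩ := h
  obtain ⟨γ', hγ', ψ', hψ', hinj'⟩ := h'
  classical
  choose! hc h0 h1 hS using hψ
  choose! hc' h0' h1' hS' using hψ'
  let P : ∀ x (hx : x ∈ S b), Path x (σ x) := fun x hx => ⟨⟨ψ x, hc x hx⟩, h0 x hx, h1 x hx⟩
  let P' : ∀ x (hx : x ∈ S b'), Path x (σ' x) :=
    fun x hx => ⟨⟨ψ' x, hc' x hx⟩, h0' x hx, h1' x hx⟩
  let Q : ∀ x (hx : x ∈ S b), Path x (σ' (σ x)) := fun x hx => (P x hx).trans (P' (σ x) (hm hx))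
  refine ⟨γ.trans γ', fun t => ?_, fun x => if hx : x ∈ S b then Q x hx else fun _ => x, ?_, ?_⟩
  · rw [Path.trans_apply]
    split_ifs
    exacts [hγ _, hγ' _]
  · intro x hx
    simp only [hx, dif_pos]
    refine ⟨(Q x hx).continuous, (Q x hx).source, (Q x hx).target, fun t => ?_⟩
    simp only [Q, Path.trans_apply]
    split_ifs
    exacts [hS x hx _, hS' _ (hm hx) _]
  · intro t x hx y hy hxy
    simp only [hx, hy, dif_pos, Q, Path.trans_apply] at hxy
    split_ifs at hxy
    · exact hinj _ hx hy hxy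
    · exact hi hx hy (hinj' _ (hm hx) (hm hy) hxy)

theorem symm (h : Monodromy S T b b' σ) (hσ : Set.BijOn σ (S b) (S b')) {ρ : X → X}
    (hρ : Set.LeftInvOn ρ σ (S b)) : Monodromy S T b' b ρ := by
  have hmaps : ∀ y ∈ S b', ρ y ∈ S b ∧ σ (ρ y) = y := by
    intro y hy
    obtain ⟨x, hx, rfl⟩ := hσ.surjOn hy
    rw [hρ hx]
    exact ⟨hx, rfl⟩
  obtain ⟨γ, hγ, ψ, hψ, hinj⟩ := h
  refine ⟨γ.symm, fun t => hγ _, fun y t => ψ (ρ y) (unitInterval.symm t), ?_, ?_⟩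
  · intro y hy
    obtain ⟨hc, h0, h1, h2⟩ := hψ _ (hmaps y hy).1
    refine ⟨hc.comp unitInterval.continuous_symm, ?_, ?_, fun t => h2 _⟩
    · simp [h1, (hmaps y hy).2]
    · simp [h0]
  · intro t y hy z hz hyz
    have := hinj _ (hmaps y hy).1 (hmaps z hz).1 hyz
    rw [← (hmaps y hy).2, this, (hmaps z hz).2]

theorem conj_swap [DecidableEq X] (h : Monodromy S T b b' σ) (hb' : (S b').Finite)
    (hcard : (S b').ncard ≤ (S b).ncard) {x y : X} (hx : x ∈ S b) (hy : y ∈ S b)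
    (hs : Monodromy S T b b (Equiv.swap x y)) :
    Monodromy S T b' b' (Equiv.swap (σ x) (σ y)) := by
  have hσ := h.bijOn hb' hcard
  have : Nonempty X := ⟨x⟩
  have hinv := hσ.injOn.leftInvOn_invFunOn
  refine (((h.symm hσ hinv).trans hs).trans h).congr ?_
  intro z hz
  obtain ⟨w, hw, rfl⟩ := hσ.surjOn hz
  simp only [Function.comp, hinv hw]
  by_cases h1 : w = x
  · simp [h1]
  by_cases h2 : w = y
  · simp [h2]
  rw [Equiv.swap_apply_of_ne_of_ne h1 h2,
    Equiv.swap_apply_of_ne_of_ne (fun h => h1 (hσ.injOn hw hx h))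
      (fun h => h2 (hσ.injOn hw hy h))]

theorem swap_of_stabilizers [DecidableEq X] (hb : (S b).Finite) {W : Set X} (hW : W ⊆ S b)
    (hstab : ∀ p ∈ W, ∀ q ∈ W, ∀ q' ∈ W, q ≠ p → q' ≠ p →
      ∃ σ : X → X, Monodromy S T b b σ ∧ σ p = p ∧ σ q = q')
    (hswap : ∃ x ∈ W, ∃ y ∈ W, x ≠ y ∧ Monodromy S T b b (Equiv.swap x y))
    {p q : X} (hp : p ∈ W) (hq : q ∈ W) (hpq : p ≠ q) :
    Monodromy S T b b (Equiv.swap p q) := by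
  obtain ⟨x, hx, y, hy, hxy, hs⟩ := hswap
  have key : ∀ u ∈ W, ∀ v ∈ W, ∀ v' ∈ W, u ≠ v → u ≠ v' →
      Monodromy S T b b (Equiv.swap u v) → Monodromy S T b b (Equiv.swap u v') := by
    intro u hu v hv v' hv' huv huv' h
    obtain ⟨σ, hσ, h1, h2⟩ := hstab u hu v hv v' hv' huv.symm huv'.symm
    have := hσ.conj_swap hb le_rfl (hW hu) (hW hv) h
    rwa [h1, h2] at this
  have key' : ∀ u ∈ W, ∀ v ∈ W, x ≠ v → u ≠ v → Monodromy S T b b (Equiv.swap u v) := by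
    intro u hu v hv hxv huv
    have h1 := key x hx y hy v hv hxy hxv hs
    rw [Equiv.swap_comm] at h1 ⊢
    exact key v hv x hx u hu hxv.symm huv.symm h1
  by_cases hxq : x = q
  · subst hxq
    rw [Equiv.swap_comm]
    exact key' _ hx _ hp hpq.symm hpq.symm
  · exact key' p hp q hq hxq hpq

theorem of_swaps [DecidableEq X] {ι : Type*} (hbT : b ∈ T) (hb : (S b).Finite) (col : X → ι)
    (hswap : ∀ x ∈ S b, ∀ y ∈ S b, x ≠ y → col x = col y →
      Monodromy S T b b (Equiv.swap x y))
    {τ : X → X} (hτ : Set.BijOn τ (S b) (S b)) (hcol : ∀ x ∈ S b, col (τ x) = col x) :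
    Monodromy S T b b τ := by
  induction hn : {x ∈ S b | τ x ≠ x}.ncard using Nat.strong_induction_on generalizing τ with
  | _ n ih =>
  by_cases hid : ∀ x ∈ S b, τ x = x
  · exact (refl hbT).congr fun x hx => (hid x hx).symm
  push Not at hid
  obtain ⟨a, ha, hτa⟩ := hid
  have hτaS := hτ.mapsTo ha
  have hsw := hswap a ha (τ a) hτaS hτa.symm (hcol a ha).symm
  have hbij : Set.BijOn (Equiv.swap a (τ a)) (S b) (S b) :=
    hsw.bijOn hb le_rfl
  have hτ' : Set.BijOn (Equiv.swap a (τ a) ∘ τ) (S b) (S b) := hbij.comp hτ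
  have hcol' : ∀ x ∈ S b, col ((Equiv.swap a (τ a) ∘ τ) x) = col x := by
    intro x hx
    rw [← hcol x hx, Function.comp]
    by_cases h1 : τ x = a
    · rw [h1, Equiv.swap_apply_left, hcol a ha]
    by_cases h2 : τ x = τ a
    · rw [h2, Equiv.swap_apply_right, hcol a ha]
    · rw [Equiv.swap_apply_of_ne_of_ne h1 h2]
  have hlt : {x ∈ S b | (Equiv.swap a (τ a) ∘ τ) x ≠ x}.ncard < n := by
    rw [← hn]
    refine Set.ncard_lt_ncard ⟨?_, ?_⟩ (hb.subset (Set.sep_subset _ _))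
    · rintro x ⟨hx, hne⟩
      refine ⟨hx, fun h => hne ?_⟩
      have h1 : x ≠ a := by rintro rfl; exact hτa h
      have h2 : x ≠ τ a := by
        rintro rfl
        exact hτa (hτ.injOn hx ha h)
      simp [h, Equiv.swap_apply_of_ne_of_ne h1 h2]
    · intro hsub
      exact (hsub (⟨ha, hτa⟩ : a ∈ {x ∈ S b | τ x ≠ x})).2 (by simp)
  have hmon := ih _ hlt hτ' hcol' rfl
  refine (hmon.trans hsw).congr fun x _ => ?_
  simp

theorem map [Nonempty X] {B' X' : Type*} [TopologicalSpace B'] [TopologicalSpace X']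
    (h : Monodromy S T b b' σ) {e : B → B'} (he : Continuous e) {f : B × X → X'}
    (hf : Continuous f) {K : Set X'} {S' : B' → Set X'} {T' : Set B'}
    (hT : ∀ t ∈ T, e t ∈ T') (hS : ∀ t ∈ T, S' (e t) = (fun x => f (t, x)) '' S t ∪ K)
    (hinj : ∀ t ∈ T, Set.InjOn (fun x => f (t, x)) (S t))
    (hdisj : ∀ t ∈ T, ∀ x ∈ S t, f (t, x) ∉ K) {σ' : X' → X'}
    (hσ : ∀ x ∈ S b, σ' (f (b, x)) = f (b', σ x)) (hK : ∀ k ∈ K, σ' k = k) :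
    Monodromy S' T' (e b) (e b') σ' := by
  classical
  obtain ⟨γ, hγ, ψ, hψ, hψi⟩ := h
  have hbT : b ∈ T := by simpa using hγ 0
  have hψS : ∀ x ∈ S b, ∀ t, ψ x t ∈ S (γ t) := fun x hx => (hψ x hx).2.2.2
  have hmem : ∀ y ∈ S' (e b), y ∉ K → ∃ x, x ∈ S b ∧ f (b, x) = y := by
    intro y hy hyK
    rw [hS b hbT] at hy
    rcases hy with ⟨x, hx, rfl⟩ | hy
    exacts [⟨x, hx, rfl⟩, absurd hy hyK]
  choose! g hgS hg using hmem
  refine ⟨γ.map he, fun t => hT _ (hγ t), fun y t => if y ∈ K then y else f (γ t, ψ (g y) t),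
    ?_, ?_⟩
  · intro y hy
    by_cases hyK : y ∈ K
    · simp only [hyK, if_true, Path.map_coe, Function.comp]
      exact ⟨continuous_const, trivial, (hK y hyK).symm, fun t => by
        rw [hS _ (hγ t)]; exact Or.inr hyK⟩
    · obtain ⟨hc, h0, h1, h2⟩ := hψ _ (hgS y hy hyK)
      simp only [hyK, if_false, Path.map_coe, Function.comp]
      refine ⟨hf.comp (γ.continuous.prodMk hc), ?_, ?_, fun t => ?_⟩
      · rw [h0, γ.source, hg y hy hyK]
      · rw [h1, γ.target, ← hσ _ (hgS y hy hyK), hg y hy hyK]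
      · rw [hS _ (hγ t)]
        exact Or.inl ⟨_, h2 t, rfl⟩
  · intro t y hy z hz hyz
    by_cases hyK : y ∈ K <;> by_cases hzK : z ∈ K <;> simp only [hyK, hzK, if_true, if_false] at hyz
    · exact hyz
    · exact absurd (hyz ▸ hyK) (hdisj _ (hγ t) _ (hψS _ (hgS z hz hzK) t))
    · exact absurd (hyz ▸ hzK) (hdisj _ (hγ t) _ (hψS _ (hgS y hy hyK) t))
    · have h1 := hinj _ (hγ t) (hψS _ (hgS y hy hyK) t) (hψS _ (hgS z hz hzK) t) hyz
      have h2 := hψi t (hgS y hy hyK) (hgS z hz hzK) h1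
      rw [← hg y hy hyK, h2, hg z hz hzK]

end Monodromy

namespace Polynomial

/-- The derivative of a bivariate polynomial with respect to the inner variable. -/
def innerDerivative (p : Polynomial (Polynomial ℂ)) : Polynomial (Polynomial ℂ) :=
  Bivariate.swap (derivative (Bivariate.swap (R := ℂ) p))

theorem evalEval_swap (x y : ℂ) (p : Polynomial (Polynomial ℂ)) :
    (Bivariate.swap p).evalEval x y = p.evalEval y x := by
  rw [← coe_aevalAeval_eq_evalEval, ← coe_aevalAeval_eq_evalEval]
  exact Bivariate.aevalAeval_swap x y p

theorem contDiff_evalEval (p : Polynomial (Polynomial ℂ)) :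
    ContDiff ℂ ω (fun z : ℂ × ℂ => p.evalEval z.1 z.2) := by
  induction p using Polynomial.induction_on' with
  | add p q hp hq => simpa using hp.add hq
  | monomial n a =>
    have : (fun z : ℂ × ℂ => (monomial n a).evalEval z.1 z.2) =
        fun z : ℂ × ℂ => a.eval z.1 * z.2 ^ n := by
      funext z
      rw [← map_evalRingHom_eval, map_monomial, eval_monomial]
      rfl
    rw [this]
    have ha : ContDiff ℂ ω (fun x => a.eval x) := by
      simpa using a.contDiff_aeval (𝕜 := ℂ) ω
    exact (ha.comp contDiff_fst).mul (contDiff_snd.pow n)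

theorem continuous_evalEval (p : Polynomial (Polynomial ℂ)) :
    Continuous (fun z : ℂ × ℂ => p.evalEval z.1 z.2) :=
  p.contDiff_evalEval.continuous

theorem hasDerivAt_evalEval_right (p : Polynomial (Polynomial ℂ)) (t x : ℂ) :
    HasDerivAt (fun x => p.evalEval t x) (p.derivative.evalEval t x) x := by
  have h := (p.map (evalRingHom t)).hasDerivAt x
  rw [derivative_map] at h
  simpa only [map_evalRingHom_eval] using h

theorem hasDerivAt_evalEval_left (p : Polynomial (Polynomial ℂ)) (t x : ℂ) :
    HasDerivAt (fun t => p.evalEval t x) (p.innerDerivative.evalEval t x) t := by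
  have h := hasDerivAt_evalEval_right (Bivariate.swap p) x t
  simp only [evalEval_swap] at h
  rwa [innerDerivative, evalEval_swap]

theorem hasDerivAt_evalEval_comp (p : Polynomial (Polynomial ℂ)) {a b : ℂ → ℂ} {a' b' z : ℂ}
    (ha : HasDerivAt a a' z) (hb : HasDerivAt b b' z) :
    HasDerivAt (fun s => p.evalEval (a s) (b s))
      (p.innerDerivative.evalEval (a z) (b z) * a' + p.derivative.evalEval (a z) (b z) * b') z := by
  have hf := (p.contDiff_evalEval.differentiable (by simp) (a z, b z)).hasFDerivAt
  set L := fderiv ℂ (fun z : ℂ × ℂ => p.evalEval z.1 z.2) (a z, b z)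
  have h1 : L (1, 0) = p.innerDerivative.evalEval (a z) (b z) := by
    have h := hf.comp_hasDerivAt (a z) ((hasDerivAt_id (a z)).prodMk (hasDerivAt_const _ (b z)))
    exact h.unique (p.hasDerivAt_evalEval_left (a z) (b z))
  have h2 : L (0, 1) = p.derivative.evalEval (a z) (b z) := by
    have h := hf.comp_hasDerivAt (b z) ((hasDerivAt_const (b z) (a z)).prodMk (hasDerivAt_id (b z)))
    exact h.unique (p.hasDerivAt_evalEval_right (a z) (b z))
  have h := hf.comp_hasDerivAt z (ha.prodMk hb)
  have : ((a', b') : ℂ × ℂ) = a' • ((1, 0) : ℂ × ℂ) + b' • ((0, 1) : ℂ × ℂ) := by simp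
  rw [this, map_add, map_smul, map_smul, h1, h2, smul_eq_mul, smul_eq_mul, mul_comm a',
    mul_comm b'] at h
  exact h

/-- The implicit function theorem for a zero of a bivariate polynomial that is simple in the outer
variable. -/
theorem exists_analyticAt_implicit (p : Polynomial (Polynomial ℂ)) {t₀ x₀ : ℂ}
    (h0 : p.evalEval t₀ x₀ = 0) (h1 : p.derivative.evalEval t₀ x₀ ≠ 0) :
    ∃ φ : ℂ → ℂ, AnalyticAt ℂ φ t₀ ∧ φ t₀ = x₀ ∧
      ∀ᶠ z : ℂ × ℂ in 𝓝 (t₀, x₀), p.evalEval z.1 z.2 = 0 ↔ φ z.1 = z.2 := by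
  have cdf : ContDiffAt ℂ ω (fun z : ℂ × ℂ => p.evalEval z.1 z.2) (t₀, x₀) :=
    p.contDiff_evalEval.contDiffAt
  have hf := (cdf.differentiableAt (by simp)).hasFDerivAt
  have h2 : fderiv ℂ (fun z : ℂ × ℂ => p.evalEval z.1 z.2) (t₀, x₀) (0, 1)
      = p.derivative.evalEval t₀ x₀ := by
    have h := hf.comp_hasDerivAt x₀ ((hasDerivAt_const x₀ t₀).prodMk (hasDerivAt_id x₀))
    exact h.unique (p.hasDerivAt_evalEval_right t₀ x₀)
  have hinv : (fderiv ℂ (fun z : ℂ × ℂ => p.evalEval z.1 z.2) (t₀, x₀) ∘L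
      .inr ℂ ℂ ℂ).IsInvertible := by
    refine ⟨ContinuousLinearEquiv.unitsEquivAut ℂ (Units.mk0 _ h1), ?_⟩
    ext
    simp [h2]
  refine ⟨cdf.implicitFunction (by simp) hinv, ?_, cdf.implicitFunction_apply_self _ hinv, ?_⟩
  · exact (cdf.contDiffAt_implicitFunction (by simp) hinv).analyticAt
  · have := cdf.eventually_apply_eq_iff_implicitFunction (by simp) hinv
    simpa only [h0] using this

/-- The fibre over `t` of the zero locus of a bivariate polynomial. -/
def fib (H : Polynomial (Polynomial ℂ)) (t : ℂ) : Set ℂ := {x | H.evalEval t x = 0}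

/-- The parameters over which all roots of `H` are simple. -/
def regularSet (H : Polynomial (Polynomial ℂ)) : Set ℂ :=
  {t | ∀ x, H.evalEval t x = 0 → H.derivative.evalEval t x ≠ 0}

variable {H : Polynomial (Polynomial ℂ)}

theorem mem_fib {t x : ℂ} : x ∈ H.fib t ↔ H.evalEval t x = 0 := Iff.rfl

theorem Monic.map_evalRingHom_ne_zero (hH : H.Monic) (t : ℂ) : H.map (evalRingHom t) ≠ 0 :=
  (hH.map _).ne_zero

theorem fib_eq_roots (hH : H.Monic) (t : ℂ) :
    H.fib t = ((H.map (evalRingHom t)).roots.toFinset : Set ℂ) := by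
  ext x
  simp [mem_fib, hH.map_evalRingHom_ne_zero t, IsRoot, map_evalRingHom_eval]

theorem fib_finite (hH : H.Monic) (t : ℂ) : (H.fib t).Finite := by
  rw [fib_eq_roots hH]
  exact Finset.finite_toSet _

theorem card_roots_map (hH : H.Monic) (t : ℂ) :
    Multiset.card (H.map (evalRingHom t)).roots = H.natDegree := by
  rw [← (IsAlgClosed.splits (H.map (evalRingHom t))).natDegree_eq_card_roots,
    hH.natDegree_map]

theorem ncard_fib_le (hH : H.Monic) (t : ℂ) : (H.fib t).ncard ≤ H.natDegree := by
  rw [fib_eq_roots hH, Set.ncard_coe_finset, ← card_roots_map hH t]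
  exact Multiset.toFinset_card_le _

theorem rootMultiplicity_eq_one {p : Polynomial ℂ} (hp : p ≠ 0) {x : ℂ} (h0 : p.eval x = 0)
    (h1 : p.derivative.eval x ≠ 0) : p.rootMultiplicity x = 1 := by
  have h2 := (rootMultiplicity_pos hp).2 h0
  have h3 : ¬ 1 < p.rootMultiplicity x := fun h =>
    h1 (isRoot_iterate_derivative_of_lt_rootMultiplicity (n := 1) h)
  omega

theorem rootMultiplicity_eq_two {p : Polynomial ℂ} (hp : p ≠ 0) {x : ℂ} (h0 : p.eval x = 0)
    (h1 : p.derivative.eval x = 0) (h2 : p.derivative.derivative.eval x ≠ 0) :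
    p.rootMultiplicity x = 2 := by
  have h3 := (one_lt_rootMultiplicity_iff_isRoot hp).2 ⟨h0, h1⟩
  have h4 : ¬ 2 < p.rootMultiplicity x := fun h =>
    h2 (isRoot_iterate_derivative_of_lt_rootMultiplicity (n := 2) h)
  omega

theorem nodup_roots_map (hH : H.Monic) {t : ℂ} (ht : t ∈ H.regularSet) :
    (H.map (evalRingHom t)).roots.Nodup := by
  refine Multiset.nodup_iff_count_le_one.2 fun x => ?_
  rw [count_roots]
  by_cases hx : H.evalEval t x = 0
  · refine (rootMultiplicity_eq_one (hH.map_evalRingHom_ne_zero t) ?_ ?_).le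
    · rwa [map_evalRingHom_eval]
    · rw [derivative_map, map_evalRingHom_eval]
      exact ht x hx
  · rw [rootMultiplicity_eq_zero]
    · exact zero_le_one
    · rwa [IsRoot, map_evalRingHom_eval]

theorem ncard_fib (hH : H.Monic) {t : ℂ} (ht : t ∈ H.regularSet) :
    (H.fib t).ncard = H.natDegree := by
  rw [fib_eq_roots hH, Set.ncard_coe_finset, ← card_roots_map hH t,
    Multiset.toFinset_card_of_nodup (nodup_roots_map hH ht)]

theorem prod_fib (hH : H.Monic) {t : ℂ} (ht : t ∈ H.regularSet) :
    ∏ x ∈ (fib_finite hH t).toFinset, (X - C x) = H.map (evalRingHom t) := by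
  classical
  have hr : (fib_finite hH t).toFinset = (H.map (evalRingHom t)).roots.toFinset := by
    ext x
    rw [Set.Finite.mem_toFinset, fib_eq_roots hH, Finset.mem_coe]
  rw [hr, Finset.prod, Multiset.toFinset_val, (nodup_roots_map hH ht).dedup]
  exact ((IsAlgClosed.splits (H.map (evalRingHom t))).eq_prod_roots_of_monic (hH.map _)).symm

end Polynomial

namespace Polynomial

variable {H : Polynomial (Polynomial ℂ)}

theorem exists_eventually_sections {t₀ : ℂ} {W : Set ℂ} (hW : W.Finite)
    (hW0 : ∀ x ∈ W, H.evalEval t₀ x = 0) (hW1 : ∀ x ∈ W, H.derivative.evalEval t₀ x ≠ 0) :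
    ∃ φ : ℂ → ℂ → ℂ, (∀ x ∈ W, φ x t₀ = x) ∧ ∀ᶠ t in 𝓝 t₀,
      (∀ x ∈ W, AnalyticAt ℂ (φ x) t ∧ H.evalEval t (φ x t) = 0 ∧
        H.derivative.evalEval t (φ x t) ≠ 0) ∧ Set.InjOn (fun x => φ x t) W := by
  have key : ∀ x ∈ W, ∃ φ : ℂ → ℂ, AnalyticAt ℂ φ t₀ ∧ φ t₀ = x ∧
      ∀ᶠ z : ℂ × ℂ in 𝓝 (t₀, x), H.evalEval z.1 z.2 = 0 ↔ φ z.1 = z.2 :=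
    fun x hx => exists_analyticAt_implicit H (hW0 x hx) (hW1 x hx)
  choose! φ hφ hφ0 hφ1 using key
  refine ⟨φ, hφ0, ?_⟩
  have hinj : ∀ x ∈ W, ∀ y ∈ W, ∀ᶠ t in 𝓝 t₀, φ x t = φ y t → x = y := by
    intro x hx y hy
    by_cases hxy : x = y
    · exact Filter.Eventually.of_forall fun t _ => hxy
    have : φ x t₀ - φ y t₀ ≠ 0 := by rwa [hφ0 x hx, hφ0 y hy, sub_ne_zero]
    filter_upwards [((hφ x hx).continuousAt.sub (hφ y hy).continuousAt).eventually_ne this]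
      with t ht h
    exact absurd (sub_eq_zero.2 h) ht
  have h1 : ∀ᶠ t in 𝓝 t₀, ∀ x ∈ W, AnalyticAt ℂ (φ x) t ∧ H.evalEval t (φ x t) = 0 ∧
      H.derivative.evalEval t (φ x t) ≠ 0 := by
    refine (Set.Finite.eventually_all hW).2 fun x hx => ?_
    have hc : ContinuousAt (fun t => (t, φ x t)) t₀ :=
      continuousAt_id.prodMk (hφ x hx).continuousAt
    have ht : Filter.Tendsto (fun t => (t, φ x t)) (𝓝 t₀) (𝓝 (t₀, x)) := by
      simpa only [ContinuousAt, hφ0 x hx] using hc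
    have hne : ∀ᶠ z : ℂ × ℂ in 𝓝 (t₀, x), H.derivative.evalEval z.1 z.2 ≠ 0 :=
      (continuous_evalEval H.derivative).continuousAt.eventually_ne (hW1 x hx)
    filter_upwards [(hφ x hx).eventually_analyticAt, ht.eventually (hφ1 x hx), ht.eventually hne]
      with t h1 h2 h3
    exact ⟨h1, h2.2 rfl, h3⟩
  have h2 : ∀ᶠ t in 𝓝 t₀, ∀ x ∈ W, ∀ y ∈ W, φ x t = φ y t → x = y :=
    (Set.Finite.eventually_all hW).2 fun x hx => (Set.Finite.eventually_all hW).2 fun y hy =>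
      hinj x hx y hy
  filter_upwards [h1, h2] with t ht1 ht2
  exact ⟨ht1, fun x hx y hy h => ht2 x hx y hy h⟩

theorem exists_sections (hH : H.Monic) {t₀ : ℂ} (ht₀ : t₀ ∈ H.regularSet) :
    ∃ φ : ℂ → ℂ → ℂ, ∃ r > 0, Metric.ball t₀ r ⊆ H.regularSet ∧
      (∀ x ∈ H.fib t₀, φ x t₀ = x) ∧
      (∀ x ∈ H.fib t₀, AnalyticOnNhd ℂ (φ x) (Metric.ball t₀ r)) ∧
      ∀ t ∈ Metric.ball t₀ r, Set.BijOn (fun x => φ x t) (H.fib t₀) (H.fib t) := by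
  obtain ⟨φ, hφ0, hφ⟩ := exists_eventually_sections (fib_finite hH t₀)
    (fun x hx => hx) (fun x hx => ht₀ x hx)
  obtain ⟨r, hr, hball⟩ := Metric.eventually_nhds_iff_ball.1 hφ
  have hbij : ∀ t ∈ Metric.ball t₀ r, Set.BijOn (fun x => φ x t) (H.fib t₀) (H.fib t) := by
    intro t ht
    obtain ⟨h1, h2⟩ := hball t ht
    have him : (fun x => φ x t) '' H.fib t₀ ⊆ H.fib t := by
      rintro _ ⟨x, hx, rfl⟩
      exact (h1 x hx).2.1
    refine ⟨Set.mapsTo_iff_image_subset.2 him, h2, ?_⟩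
    refine (Set.eq_of_subset_of_ncard_le him ?_ (fib_finite hH t)).symm.subset
    rw [h2.ncard_image, ncard_fib hH ht₀]
    exact ncard_fib_le hH t
  refine ⟨φ, r, hr, fun t ht x hx => ?_, hφ0, fun x hx t ht => ((hball t ht).1 x hx).1, hbij⟩
  obtain ⟨y, hy, rfl⟩ := (hbij t ht).surjOn hx
  exact ((hball t ht).1 y hy).2.2

theorem finite_compl_regularSet (hH : H.Monic) (h0 : (0 : ℂ) ∈ H.regularSet) :
    (H.regularSetᶜ).Finite := by
  by_cases hn : H.natDegree = 0
  · rw [hH.natDegree_eq_zero.1 hn]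
    convert Set.finite_empty
    rw [Set.compl_empty_iff, Set.eq_univ_iff_forall]
    intro t x hx
    simp at hx
  have hres : ∀ t : ℂ, (resultant H H.derivative).eval t =
      resultant (H.map (evalRingHom t)) (H.map (evalRingHom t)).derivative := by
    intro t
    have h1 : (H.map (evalRingHom t)).natDegree = H.natDegree := hH.natDegree_map _
    have h2 : (H.map (evalRingHom t)).derivative.natDegree = H.derivative.natDegree := by
      rw [natDegree_derivative, natDegree_derivative, h1]
    have := resultant_map_map H H.derivative H.natDegree H.derivative.natDegree (evalRingHom t)
    rw [derivative_map] at h2 ⊢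
    rw [h1, h2, this]
    rfl
  have hiff : ∀ t : ℂ, (resultant H H.derivative).eval t = 0 ↔ t ∉ H.regularSet := by
    intro t
    rw [hres, resultant_eq_zero_iff,
      isCoprime_iff_aeval_ne_zero_of_isAlgClosed ℂ ℂ]
    simp only [regularSet, Set.mem_ofPred_eq, derivative_map, coe_aeval_eq_eval,
      map_evalRingHom_eval]
    push Not
    exact ⟨fun h => h.2, fun h => ⟨Or.inl (hH.map_evalRingHom_ne_zero t), h⟩⟩
  have hne : resultant H H.derivative ≠ 0 := by
    intro h
    exact (hiff 0).1 (by rw [h, eval_zero]) h0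
  refine ((resultant H H.derivative).roots.toFinset.finite_toSet).subset fun t ht => ?_
  rw [Finset.mem_coe, Multiset.mem_toFinset, mem_roots hne]
  exact (hiff t).2 ht

end Polynomial

namespace Monodromy

variable {B X : Type*} [TopologicalSpace B] [TopologicalSpace X] {S : B → Set X} {T : Set B}
  {b b' : B} {σ : X → X}

theorem source_mem (h : Monodromy S T b b' σ) : b ∈ T := by
  obtain ⟨γ, hγ, -⟩ := h
  simpa using hγ 0

theorem target_mem (h : Monodromy S T b b' σ) : b' ∈ T := by
  obtain ⟨γ, hγ, -⟩ := h
  simpa using hγ 1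

theorem of_sections {V : Set B} (hV : V ⊆ T) (hjoin : JoinedIn V b b') (φ : X → B → X)
    (hφc : ∀ x ∈ S b, ContinuousOn (φ x) V) (hφ : ∀ x ∈ S b, φ x b = x)
    (hmaps : ∀ t ∈ V, Set.MapsTo (fun x => φ x t) (S b) (S t))
    (hinj : ∀ t ∈ V, Set.InjOn (fun x => φ x t) (S b)) :
    Monodromy S T b b' (fun x => φ x b') := by
  obtain ⟨γ, hγ⟩ := hjoin
  refine ⟨γ, fun t => hV (hγ t), fun x t => φ x (γ t), fun x hx => ⟨?_, ?_, ?_, ?_⟩, ?_⟩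
  · exact (hφc x hx).comp_continuous γ.continuous hγ
  · simp [hφ x hx]
  · simp
  · exact fun t => hmaps _ (hγ t) hx
  · exact fun t => hinj _ (hγ t)

variable {H : Polynomial (Polynomial ℂ)}

open Polynomial

theorem bijOn_fib (hH : H.Monic) {t t' : ℂ} {σ : ℂ → ℂ}
    (h : Monodromy H.fib H.regularSet t t' σ) : Set.BijOn σ (H.fib t) (H.fib t') :=
  h.bijOn (fib_finite hH t') (by rw [ncard_fib hH h.source_mem, ncard_fib hH h.target_mem])

theorem exists_inverse (hH : H.Monic) {t t' : ℂ} {σ : ℂ → ℂ}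
    (h : Monodromy H.fib H.regularSet t t' σ) :
    ∃ ρ, Monodromy H.fib H.regularSet t' t ρ ∧ Set.LeftInvOn ρ σ (H.fib t) :=
  have hb := bijOn_fib hH h
  ⟨_, h.symm hb hb.injOn.leftInvOn_invFunOn, hb.injOn.leftInvOn_invFunOn⟩

theorem exists_of_mem_regularSet (hH : H.Monic) (h0 : (0 : ℂ) ∈ H.regularSet) {t t' : ℂ}
    (ht : t ∈ H.regularSet) (ht' : t' ∈ H.regularSet) :
    ∃ σ, Monodromy H.fib H.regularSet t t' σ := by
  have hconn : IsPreconnected H.regularSet := by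
    have := ((finite_compl_regularSet hH h0).countable.isPathConnected_compl_of_one_lt_rank
      (by rw [Complex.rank_real_complex]; exact Nat.one_lt_ofNat)).isConnected.isPreconnected
    rwa [compl_compl] at this
  refine hconn.induction₂ (fun t t' => ∃ σ, Monodromy H.fib H.regularSet t t' σ) ?_ ?_ ?_ ht ht'
  · intro x hx
    obtain ⟨φ, r, hr, hball, hφ0, hφ, hbij⟩ := exists_sections hH hx
    filter_upwards [mem_nhdsWithin_of_mem_nhds (Metric.ball_mem_nhds x hr)] with y hy
    exact ⟨_, of_sections hball
      ((convex_ball x r).isPathConnected ⟨x, Metric.mem_ball_self hr⟩ |>.joinedIn _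
        (Metric.mem_ball_self hr) _ hy) φ
      (fun z hz => (hφ z hz).continuousOn) hφ0 (fun t ht => (hbij t ht).mapsTo)
      (fun t ht => (hbij t ht).injOn)⟩
  · rintro x y z - - - ⟨σ, hσ⟩ ⟨σ', hσ'⟩
    exact ⟨_, hσ.trans hσ'⟩
  · rintro x y - - ⟨σ, hσ⟩
    obtain ⟨ρ, hρ, -⟩ := hσ.exists_inverse hH
    exact ⟨ρ, hρ⟩

theorem evalEval_eq_zero_iff {h g : Polynomial (Polynomial ℂ)} (hH : H = h * g) {t t' : ℂ}
    {σ : ℂ → ℂ} (hσ : Monodromy H.fib H.regularSet t t' σ) {x : ℂ} (hx : x ∈ H.fib t) :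
    h.evalEval t' (σ x) = 0 ↔ h.evalEval t x = 0 := by
  obtain ⟨γ, hγ, ψ, hψ, -⟩ := hσ
  obtain ⟨hc, h0, h1, hS⟩ := hψ x hx
  have hcγ : Continuous fun s => (γ s, ψ x s) := γ.continuous.prodMk hc
  have hclosed : ∀ p : Polynomial (Polynomial ℂ),
      IsClosed {s | p.evalEval (γ s) (ψ x s) = 0} := fun p =>
    isClosed_eq ((continuous_evalEval p).comp hcγ) continuous_const
  have hor : ∀ s, h.evalEval (γ s) (ψ x s) = 0 ∨ g.evalEval (γ s) (ψ x s) = 0 := by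
    intro s
    have := hS s
    rwa [mem_fib, hH, evalEval_mul, mul_eq_zero] at this
  have hnot : ∀ s, h.evalEval (γ s) (ψ x s) = 0 → g.evalEval (γ s) (ψ x s) ≠ 0 := by
    intro s h1 h2
    refine hγ s _ (hS s) ?_
    rw [hH, derivative_mul, evalEval_add, evalEval_mul, evalEval_mul, h1, h2]
    simp
  have hopen : IsClopen {s | h.evalEval (γ s) (ψ x s) = 0} := by
    refine ⟨hclosed h, ?_⟩
    rw [← isClosed_compl_iff]
    convert hclosed g using 1
    ext s
    exact ⟨fun h => (hor s).resolve_left h, fun h h' => hnot s h' h⟩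
  have hpre := isClopen_iff.1 hopen
  have key : h.evalEval (γ 1) (ψ x 1) = 0 ↔ h.evalEval (γ 0) (ψ x 0) = 0 := by
    change (1 : unitInterval) ∈ {s | h.evalEval (γ s) (ψ x s) = 0} ↔
      (0 : unitInterval) ∈ {s | h.evalEval (γ s) (ψ x s) = 0}
    rcases hpre with h | h <;> simp [h]
  simpa [h0, h1] using key

end Monodromy

/-- A real-valued function on `ℂ` that is bounded by a polynomial in the norm. -/
def PolyGrowth (r : ℂ → ℝ) : Prop := ∃ M : ℝ, ∃ N : ℕ, 0 ≤ M ∧ ∀ t, r t ≤ M * (1 + ‖t‖) ^ N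

namespace PolyGrowth

variable {r s : ℂ → ℝ}

theorem const (M : ℝ) : PolyGrowth fun _ => M :=
  ⟨|M|, 0, abs_nonneg M, fun t => by simpa using le_abs_self M⟩

theorem norm : PolyGrowth fun t => ‖t‖ :=
  ⟨1, 1, zero_le_one, fun t => by simp⟩

theorem mono (hs : PolyGrowth s) (h : ∀ t, r t ≤ s t) : PolyGrowth r := by
  obtain ⟨M, N, hM, hs⟩ := hs
  exact ⟨M, N, hM, fun t => (h t).trans (hs t)⟩

theorem add (hr : PolyGrowth r) (hs : PolyGrowth s) : PolyGrowth fun t => r t + s t := by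
  obtain ⟨M, N, hM, hr⟩ := hr
  obtain ⟨M', N', hM', hs⟩ := hs
  refine ⟨M + M', max N N', add_nonneg hM hM', fun t => ?_⟩
  have h1 : (1 : ℝ) ≤ 1 + ‖t‖ := by simp
  rw [add_mul]
  refine add_le_add ?_ ?_
  · exact (hr t).trans (by gcongr; exact le_max_left _ _)
  · exact (hs t).trans (by gcongr; exact le_max_right _ _)

theorem mul (hr : PolyGrowth r) (hs : PolyGrowth s) (hr0 : ∀ t, 0 ≤ r t) (hs0 : ∀ t, 0 ≤ s t) :
    PolyGrowth fun t => r t * s t := by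
  obtain ⟨M, N, hM, hr⟩ := hr
  obtain ⟨M', N', hM', hs⟩ := hs
  refine ⟨M * M', N + N', mul_nonneg hM hM', fun t => ?_⟩
  calc r t * s t ≤ (M * (1 + ‖t‖) ^ N) * (M' * (1 + ‖t‖) ^ N') :=
        mul_le_mul (hr t) (hs t) (hs0 t) ((hr0 t).trans (hr t))
    _ = _ := by ring

theorem pow (hr : PolyGrowth r) (hr0 : ∀ t, 0 ≤ r t) (n : ℕ) : PolyGrowth fun t => r t ^ n := by
  induction n with
  | zero => simpa using const 1
  | succ n ih => simpa only [pow_succ] using ih.mul hr (fun t => pow_nonneg (hr0 t) n) hr0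

theorem sum {ι : Type*} (u : Finset ι) {r : ι → ℂ → ℝ} (hr : ∀ i ∈ u, PolyGrowth (r i)) :
    PolyGrowth fun t => ∑ i ∈ u, r i t := by
  classical
  induction u using Finset.induction_on with
  | empty => simpa using const 0
  | insert i u hi ih =>
    simp only [Finset.sum_insert hi]
    exact (hr i (Finset.mem_insert_self i u)).add
      (ih fun j hj => hr j (Finset.mem_insert_of_mem hj))

theorem norm_eval (p : Polynomial ℂ) : PolyGrowth fun t => ‖p.eval t‖ := by
  induction p using Polynomial.induction_on' with
  | add p q hp hq =>
    exact (hp.add hq).mono fun t => by rw [Polynomial.eval_add]; exact norm_add_le _ _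
  | monomial n a =>
    simp only [Polynomial.eval_monomial, norm_mul, norm_pow]
    exact (const _).mul (norm.pow (fun t => norm_nonneg t) n) (fun _ => norm_nonneg a)
      (fun t => pow_nonneg (norm_nonneg t) n)

end PolyGrowth

/-- An entire function of polynomial growth is a polynomial. -/
theorem exists_polynomial_eq_of_growth {g : ℂ → ℂ} (hg : Differentiable ℂ g) {M : ℝ} {N : ℕ}
    (hM : ∀ t, ‖g t‖ ≤ M * (1 + ‖t‖) ^ N) : ∃ p : Polynomial ℂ, ∀ t, p.eval t = g t := by
  induction N generalizing g M with
  | zero =>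
    refine ⟨Polynomial.C (g 0), fun t => ?_⟩
    rw [Polynomial.eval_C]
    refine hg.apply_eq_apply_of_bounded ?_ _ _
    rw [isBounded_iff_forall_norm_le]
    refine ⟨M, ?_⟩
    rintro _ ⟨t, rfl⟩
    simpa using hM t
  | succ N ih =>
    have hd : Differentiable ℂ (dslope g 0) := by
      rw [← differentiableOn_univ] at hg ⊢
      exact (Complex.differentiableOn_dslope Filter.univ_mem).2 hg
    obtain ⟨K, hK⟩ := (isCompact_closedBall (0 : ℂ) 1).exists_bound_of_continuousOn
      hd.continuous.continuousOn
    have hM0 : 0 ≤ M := by simpa using (norm_nonneg _).trans (hM 0)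
    have hb : ∀ t, ‖dslope g 0 t‖ ≤ max (4 * M) K * (1 + ‖t‖) ^ N := by
      intro t
      have h1 : (1 : ℝ) ≤ (1 + ‖t‖) ^ N := one_le_pow₀ (by simp)
      by_cases ht : ‖t‖ ≤ 1
      · have h2 := hK t (by simpa using ht)
        have h3 := (norm_nonneg _).trans h2
        calc ‖dslope g 0 t‖ ≤ K * 1 := by simpa using h2
          _ ≤ _ := by gcongr; exact le_max_right _ _
      · push Not at ht
        have ht0 : t ≠ 0 := by rintro rfl; simp at ht; linarith
        have hg0 : ‖g 0‖ ≤ M := by simpa using hM 0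
        rw [dslope_of_ne _ ht0, slope_def_field, sub_zero, norm_div, div_le_iff₀ (by linarith)]
        calc ‖g t - g 0‖ ≤ M * (1 + ‖t‖) ^ (N + 1) + M :=
              (norm_sub_le _ _).trans (add_le_add (hM t) hg0)
          _ ≤ 4 * M * (1 + ‖t‖) ^ N * ‖t‖ := by
              have h5 : M ≤ M * (1 + ‖t‖) ^ N * ‖t‖ := by
                have : M * (1 * 1) ≤ M * ((1 + ‖t‖) ^ N * ‖t‖) := by gcongr
                linarith
              have h6 : M * (1 + ‖t‖) ^ N * 1 ≤ M * (1 + ‖t‖) ^ N * ‖t‖ := by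
                gcongr
              rw [pow_succ]
              linarith
          _ ≤ max (4 * M) K * (1 + ‖t‖) ^ N * ‖t‖ := by gcongr; exact le_max_left _ _
    obtain ⟨p, hp⟩ := ih hd hb
    refine ⟨Polynomial.X * p + Polynomial.C (g 0), fun t => ?_⟩
    have := sub_smul_dslope g 0 t
    simp only [Polynomial.eval_add, Polynomial.eval_mul, Polynomial.eval_X, Polynomial.eval_C, hp]
    rw [sub_zero, smul_eq_mul] at this
    rw [this, sub_add_cancel]

/-- Riemann's theorem on removable singularities, for finitely many points and a continuous
bound. -/
theorem exists_differentiable_extension {E : Set ℂ} (hE : E.Finite) {c : ℂ → ℂ} {R : ℂ → ℝ}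
    (hR : Continuous R) (hc : DifferentiableOn ℂ c Eᶜ) (hb : ∀ t ∈ Eᶜ, ‖c t‖ ≤ R t) :
    ∃ g : ℂ → ℂ, Differentiable ℂ g ∧ Set.EqOn g c Eᶜ ∧ ∀ t, ‖g t‖ ≤ R t := by
  induction E, hE using Set.Finite.induction_on generalizing c with
  | empty =>
    rw [Set.compl_empty] at hc
    exact ⟨c, differentiableOn_univ.1 hc, fun _ _ => rfl, fun t => hb t (by simp)⟩
  | @insert e E heE hE ih =>
    set c' := Function.update c e (Filter.limUnder (𝓝[≠] e) c)
    have hopen : IsOpen Eᶜ := hE.isClosed.isOpen_compl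
    have hset : (insert e E)ᶜ = Eᶜ \ {e} := by
      ext x; simp [not_or, and_comm]
    rw [hset] at hc hb
    have hEn : Eᶜ ∈ 𝓝 e := hopen.mem_nhds heE
    have hdiff : ∀ z ∈ Eᶜ, DifferentiableAt ℂ c' z := by
      intro z hz
      by_cases hze : z = e
      · subst hze
        have hRb : ∀ᶠ t in 𝓝 z, R t ≤ R z + 1 :=
          (hR.tendsto z).eventually_le_const (by linarith)
        have hmem := Filter.inter_mem hEn hRb
        refine (Complex.differentiableOn_update_limUnder_of_bddAbove hmem
          (hc.mono (Set.sdiff_subset_sdiff_left Set.inter_subset_left)) ?_).differentiableAt hmem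
        refine ⟨R z + 1, ?_⟩
        rintro _ ⟨t, ⟨⟨ht1, ht2⟩, ht3⟩, rfl⟩
        exact (hb t ⟨ht1, ht3⟩).trans ht2
      · have hd : DifferentiableAt ℂ c z := hc.differentiableAt
          ((hopen.sdiff isClosed_singleton).mem_nhds ⟨hz, hze⟩)
        refine hd.congr_of_eventuallyEq ?_
        filter_upwards [isOpen_compl_singleton.mem_nhds hze] with w hw
        exact Function.update_of_ne hw _ _
    have hb' : ∀ t ∈ Eᶜ, ‖c' t‖ ≤ R t := by
      intro t ht
      by_cases hte : t = e
      · subst hte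
        have h1 : Filter.Tendsto (fun w => ‖c' w‖) (𝓝[≠] t) (𝓝 ‖c' t‖) :=
          ((hdiff t ht).continuousAt.norm.tendsto).mono_left nhdsWithin_le_nhds
        have h2 : Filter.Tendsto R (𝓝[≠] t) (𝓝 (R t)) := (hR.tendsto t).mono_left nhdsWithin_le_nhds
        refine le_of_tendsto_of_tendsto h1 h2 ?_
        filter_upwards [mem_nhdsWithin_of_mem_nhds hEn, self_mem_nhdsWithin] with w hw hwt
        rw [show c' w = c w from Function.update_of_ne hwt _ _]
        exact hb w ⟨hw, hwt⟩
      · rw [show c' t = c t from Function.update_of_ne hte _ _]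
        exact hb t ⟨ht, hte⟩
    obtain ⟨g, hg, hgc, hgb⟩ := ih (fun z hz => (hdiff z hz).differentiableWithinAt) hb'
    refine ⟨g, hg, fun t ht => ?_, hgb⟩
    rw [hset] at ht
    rw [hgc ht.1]
    exact Function.update_of_ne ht.2 _ _

/-- A holomorphic function of polynomial growth on the complement of a finite set is a
polynomial. -/
theorem exists_polynomial_eqOn {E : Set ℂ} (hE : E.Finite) {c : ℂ → ℂ} {R : ℂ → ℝ}
    (hR : PolyGrowth R) (hc : DifferentiableOn ℂ c Eᶜ) (hb : ∀ t ∈ Eᶜ, ‖c t‖ ≤ R t) :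
    ∃ p : Polynomial ℂ, ∀ t ∈ Eᶜ, p.eval t = c t := by
  obtain ⟨M, N, -, hM⟩ := hR
  obtain ⟨g, hg, hgc, hgb⟩ := exists_differentiable_extension hE
    (R := fun t => M * (1 + ‖t‖) ^ N) (by fun_prop) hc (fun t ht => (hb t ht).trans (hM t))
  obtain ⟨p, hp⟩ := exists_polynomial_eq_of_growth hg hgb
  exact ⟨p, fun t ht => (hp t).trans (hgc ht)⟩

namespace Polynomial

theorem differentiableAt_coeff_prod_X_sub_C {ι : Type*} (s : Finset ι) {φ : ι → ℂ → ℂ} {t : ℂ}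
    (hφ : ∀ i ∈ s, DifferentiableAt ℂ (φ i) t) (k : ℕ) :
    DifferentiableAt ℂ (fun t => (∏ i ∈ s, (X - C (φ i t))).coeff k) t := by
  classical
  induction s using Finset.induction_on generalizing k with
  | empty => simp
  | insert i s hi ih =>
    have ih' := ih fun j hj => hφ j (Finset.mem_insert_of_mem hj)
    have hi' := hφ i (Finset.mem_insert_self i s)
    simp only [Finset.prod_insert hi, sub_mul, coeff_sub, coeff_C_mul]
    cases k with
    | zero =>
      simp only [coeff_X_mul_zero, zero_sub]
      exact (hi'.mul (ih' 0)).neg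
    | succ k =>
      simp only [coeff_X_mul]
      exact (ih' k).sub (hi'.mul (ih' (k + 1)))

theorem norm_coeff_prod_X_sub_C_le (s : Finset ℂ) {R : ℝ} (hs : ∀ x ∈ s, ‖x‖ ≤ R) (k : ℕ) :
    ‖(∏ x ∈ s, (X - C x)).coeff k‖ ≤ (1 + R) ^ s.card := by
  induction s using Finset.induction_on generalizing k with
  | empty =>
    simp only [Finset.prod_empty, coeff_one, Finset.card_empty, pow_zero]
    split_ifs <;> simp
  | insert x s hx ih =>
    have ih' := ih fun j hj => hs j (Finset.mem_insert_of_mem hj)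
    have hx' := hs x (Finset.mem_insert_self x s)
    have hR : 0 ≤ R := (norm_nonneg _).trans hx'
    have h0 : 0 ≤ (1 + R) ^ s.card := by positivity
    have hmul : ∀ j, ‖x * (∏ x ∈ s, (X - C x)).coeff j‖ ≤ R * (1 + R) ^ s.card := fun j => by
      rw [norm_mul]
      gcongr
      exact ih' j
    rw [Finset.prod_insert hx, Finset.card_insert_of_notMem hx, sub_mul, coeff_sub, coeff_C_mul,
      pow_succ]
    cases k with
    | zero =>
      have := hmul 0
      rw [coeff_X_mul_zero, zero_sub, norm_neg]
      linarith
    | succ k =>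
      rw [coeff_X_mul]
      have h1 := norm_sub_le ((∏ x ∈ s, (X - C x)).coeff k)
        (x * (∏ x ∈ s, (X - C x)).coeff (k + 1))
      linarith [ih' k, hmul (k + 1)]

variable {H : Polynomial (Polynomial ℂ)}

theorem norm_le_of_mem_fib (hH : H.Monic) {t x : ℂ} (hx : x ∈ H.fib t) :
    ‖x‖ ≤ 1 + ∑ i ∈ Finset.range H.natDegree, ‖(H.coeff i).eval t‖ := by
  have hr : (H.map (evalRingHom t)).IsRoot x := by
    rw [IsRoot, map_evalRingHom_eval]
    exact hx
  have h := (hr.norm_lt_cauchyBound (hH.map_evalRingHom_ne_zero t)).le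
  rw [cauchyBound, (hH.map (evalRingHom t)).leadingCoeff, nnnorm_one, div_one,
    hH.natDegree_map] at h
  have h2 : (Finset.range H.natDegree).sup (fun i => ‖(H.map (evalRingHom t)).coeff i‖₊) ≤
      ∑ i ∈ Finset.range H.natDegree, ‖(H.coeff i).eval t‖₊ := by
    refine Finset.sup_le fun i hi => ?_
    rw [coeff_map, coe_evalRingHom]
    exact Finset.single_le_sum (f := fun i => ‖(H.coeff i).eval t‖₊) (fun _ _ => zero_le) hi
  have h3 : ‖x‖₊ ≤ 1 + ∑ i ∈ Finset.range H.natDegree, ‖(H.coeff i).eval t‖₊ := by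
    rw [add_comm]
    exact h.trans (by gcongr)
  have h4 := NNReal.coe_le_coe.2 h3
  push_cast at h4
  simpa using h4

/-- A holomorphically varying family of subsets of the fibres of a monic polynomial is cut out by
a polynomial. -/
theorem exists_polynomial_of_family (hH : H.Monic) (h0 : (0 : ℂ) ∈ H.regularSet)
    {A : ℂ → Finset ℂ} (hA : ∀ t ∈ H.regularSet, (A t : Set ℂ) ⊆ H.fib t)
    (hloc : ∀ t₀ ∈ H.regularSet, ∃ φ : ℂ → ℂ → ℂ,
      (∀ x ∈ A t₀, DifferentiableAt ℂ (φ x) t₀) ∧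
      ∀ᶠ t in 𝓝 t₀, Set.BijOn (fun x => φ x t) (A t₀) (A t)) :
    ∃ p : Polynomial (Polynomial ℂ), ∀ t ∈ H.regularSet,
      p.map (evalRingHom t) = ∏ x ∈ A t, (X - C x) := by
  set c : ℕ → ℂ → ℂ := fun k t => (∏ x ∈ A t, (X - C x)).coeff k with hc
  have hcard : ∀ t ∈ H.regularSet, (A t).card ≤ H.natDegree := by
    intro t ht
    rw [← Set.ncard_coe_finset]
    exact (Set.ncard_le_ncard (hA t ht) (fib_finite hH t)).trans (ncard_fib_le hH t)
  have hdiff : ∀ k, DifferentiableOn ℂ (c k) H.regularSet := by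
    intro k t₀ ht₀
    obtain ⟨φ, hφ, hbij⟩ := hloc t₀ ht₀
    refine DifferentiableAt.differentiableWithinAt ?_
    refine (differentiableAt_coeff_prod_X_sub_C (A t₀) hφ k).congr_of_eventuallyEq ?_
    filter_upwards [hbij] with t ht
    simp only [hc]
    congr 1
    symm
    refine Finset.prod_bij (fun x _ => φ x t) (fun x hx => ht.mapsTo hx)
      (fun x hx y hy h => ht.injOn hx hy h) (fun y hy => ?_) (fun _ _ => rfl)
    obtain ⟨x, hx, rfl⟩ := ht.surjOn hy
    exact ⟨x, hx, rfl⟩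
  have hgrowth : ∀ k, ∃ p : Polynomial ℂ, ∀ t ∈ H.regularSet, p.eval t = c k t := by
    intro k
    set R : ℂ → ℝ := fun t => 1 + ∑ i ∈ Finset.range H.natDegree, ‖(H.coeff i).eval t‖ with hR
    have hR0 : ∀ t, 0 ≤ R t := fun t => by positivity
    have hRg : PolyGrowth R := (PolyGrowth.const 1).add
      (PolyGrowth.sum _ fun i _ => PolyGrowth.norm_eval (H.coeff i))
    have hRg' : PolyGrowth fun t => (1 + R t) ^ H.natDegree :=
      ((PolyGrowth.const 1).add hRg).pow (fun t => by linarith [hR0 t]) _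
    have := exists_polynomial_eqOn (finite_compl_regularSet hH h0) (c := c k) hRg'
      (by rw [compl_compl]; exact hdiff k) (fun t ht => ?_)
    · simpa only [compl_compl] using this
    rw [compl_compl] at ht
    refine (norm_coeff_prod_X_sub_C_le (A t)
      (fun x hx => norm_le_of_mem_fib hH (hA t ht hx)) k).trans ?_
    exact pow_le_pow_right₀ (by linarith [hR0 t]) (hcard t ht)
  choose p hp using hgrowth
  refine ⟨∑ k ∈ Finset.range (H.natDegree + 1), monomial k (p k), fun t ht => ?_⟩
  ext k
  rw [coeff_map, finsetSum_coeff]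
  simp only [coeff_monomial, Finset.sum_ite_eq', Finset.mem_range, Nat.lt_succ_iff]
  split_ifs with hk
  · exact hp k t ht
  · rw [map_zero, eq_comm]
    refine coeff_eq_zero_of_natDegree_lt ?_
    rw [natDegree_finsetProd_X_sub_C_eq_card]
    exact (hcard t ht).trans_lt (not_le.1 hk)

theorem eq_of_map_evalRingHom_eq {p q : Polynomial (Polynomial ℂ)} {T : Set ℂ} (hT : T.Infinite)
    (h : ∀ t ∈ T, p.map (evalRingHom t) = q.map (evalRingHom t)) : p = q := by
  ext1 k
  refine eq_of_infinite_eval_eq _ _ (hT.mono fun t ht => ?_)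
  have := congrArg (fun r => r.coeff k) (h t ht)
  simpa [coeff_map] using this

end Polynomial

open Polynomial in
/-- The monodromy group of a monic polynomial acts transitively on the roots of each irreducible
factor. -/
theorem Monodromy.exists_of_irreducible {H h : Polynomial (Polynomial ℂ)} (hH : H.Monic)
    (h0 : (0 : ℂ) ∈ H.regularSet) (hirr : Irreducible h) (hdvd : h ∣ H) {x x' : ℂ}
    (hx : h.evalEval 0 x = 0) (hx' : h.evalEval 0 x' = 0) :
    ∃ σ : ℂ → ℂ, Monodromy H.fib H.regularSet 0 0 σ ∧ σ x = x' := by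
  classical
  have hmem : ∀ {y}, h.evalEval 0 y = 0 → y ∈ H.fib 0 := fun {y} hy => by
    have := evalEval_dvd 0 y hdvd
    rwa [hy, zero_dvd_iff] at this
  let A : ℂ → Finset ℂ := fun t => (fib_finite hH t).toFinset.filter
    fun y => ∃ σ, Monodromy H.fib H.regularSet 0 t σ ∧ σ x = y
  have hAmem : ∀ t y, y ∈ A t ↔ ∃ σ, Monodromy H.fib H.regularSet 0 t σ ∧ σ x = y := by
    intro t y
    simp only [A, Finset.mem_filter, Set.Finite.mem_toFinset, and_iff_right_iff_imp]
    rintro ⟨σ, hσ, rfl⟩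
    exact hσ.mapsTo (hmem hx)
  let A' : ℂ → Finset ℂ := fun t => (fib_finite hH t).toFinset \ A t
  have hloc : ∀ t₀ ∈ H.regularSet, ∃ φ : ℂ → ℂ → ℂ,
      (∀ y ∈ H.fib t₀, DifferentiableAt ℂ (φ y) t₀) ∧
      ∀ᶠ t in 𝓝 t₀, Set.BijOn (fun y => φ y t) (H.fib t₀) (H.fib t) ∧
        ∀ y ∈ H.fib t₀, y ∈ A t₀ ↔ φ y t ∈ A t := by
    intro t₀ ht₀
    obtain ⟨φ, r, hr, hball, hφ0, hφ, hbij⟩ := exists_sections hH ht₀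
    refine ⟨φ, fun y hy => (hφ y hy t₀ (Metric.mem_ball_self hr)).differentiableAt, ?_⟩
    filter_upwards [Metric.ball_mem_nhds t₀ hr] with t ht
    have hm : Monodromy H.fib H.regularSet t₀ t (fun y => φ y t) := of_sections hball
      ((convex_ball t₀ r).isPathConnected ⟨t₀, Metric.mem_ball_self hr⟩ |>.joinedIn _
        (Metric.mem_ball_self hr) _ ht) φ
      (fun z hz => (hφ z hz).continuousOn) hφ0 (fun t ht => (hbij t ht).mapsTo)
      (fun t ht => (hbij t ht).injOn)
    refine ⟨hbij t ht, fun y hy => ?_⟩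
    rw [hAmem, hAmem]
    constructor
    · rintro ⟨σ, hσ, rfl⟩
      exact ⟨_, hσ.trans hm, rfl⟩
    · rintro ⟨σ, hσ, hσx⟩
      obtain ⟨ρ, hρ, hinv⟩ := hm.exists_inverse hH
      refine ⟨_, hσ.trans hρ, ?_⟩
      rw [Function.comp, hσx]
      exact hinv hy
  obtain ⟨p, hp⟩ := exists_polynomial_of_family hH h0 (A := A)
    (fun t _ y hy => by
      have := (Finset.mem_filter.1 hy).1
      simpa using this) (fun t₀ ht₀ => by
      obtain ⟨φ, hφ, hev⟩ := hloc t₀ ht₀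
      have hsub : ∀ t, ∀ y ∈ A t, y ∈ H.fib t := fun t y hy => by
        have := (Finset.mem_filter.1 hy).1
        simpa using this
      refine ⟨φ, fun y hy => hφ y (hsub _ y hy), ?_⟩
      filter_upwards [hev] with t ht
      refine ⟨fun y hy => (ht.2 y (hsub _ y hy)).1 hy,
        ht.1.injOn.mono fun y hy => hsub _ y hy, fun z hz => ?_⟩
      obtain ⟨y, hy, rfl⟩ := ht.1.surjOn (hsub _ z hz)
      exact ⟨y, (ht.2 y hy).2 hz, rfl⟩)
  have hsub' : ∀ t, ∀ y ∈ A' t, y ∈ H.fib t := fun t y hy => by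
    have := (Finset.mem_sdiff.1 hy).1
    simpa using this
  have hA' : ∀ t, ∀ y ∈ H.fib t, y ∈ A' t ↔ y ∉ A t := fun t y hy => by
    simp [A', hy]
  obtain ⟨q, hq⟩ := exists_polynomial_of_family hH h0 (A := A')
    (fun t _ y hy => hsub' t y hy) (fun t₀ ht₀ => by
      obtain ⟨φ, hφ, hev⟩ := hloc t₀ ht₀
      refine ⟨φ, fun y hy => hφ y (hsub' _ y hy), ?_⟩
      filter_upwards [hev] with t ht
      refine ⟨fun y hy => ?_, ht.1.injOn.mono fun y hy => hsub' _ y hy, fun z hz => ?_⟩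
      · have hyf := hsub' _ y hy
        exact (hA' t _ (ht.1.mapsTo hyf)).2 fun hn =>
          (hA' t₀ y hyf).1 hy ((ht.2 y hyf).2 hn)
      · obtain ⟨y, hy, rfl⟩ := ht.1.surjOn (hsub' _ z hz)
        exact ⟨y, (hA' _ y hy).2 fun hn =>
          (hA' t _ (ht.1.mapsTo hy)).1 hz ((ht.2 y hy).1 hn), rfl⟩)
  have hpq : H = p * q := by
    have hinf : H.regularSet.Infinite := by
      have := (finite_compl_regularSet hH h0).infinite_compl
      rwa [compl_compl] at this
    refine eq_of_map_evalRingHom_eq hinf fun t ht => ?_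
    rw [Polynomial.map_mul, hp t ht, hq t ht, ← prod_fib hH ht, mul_comm]
    exact (Finset.prod_sdiff (Finset.filter_subset _ _)).symm
  have heval : ∀ (r : Polynomial (Polynomial ℂ)) (B : Finset ℂ),
      r.map (evalRingHom 0) = ∏ y ∈ B, (Polynomial.X - Polynomial.C y) →
      ∀ y, r.evalEval 0 y = 0 ↔ y ∈ B := by
    intro r B hr y
    rw [← map_evalRingHom_eval, hr, Polynomial.eval_prod, Finset.prod_eq_zero_iff]
    simp [sub_eq_zero]
  have hxA : x ∈ A 0 := (hAmem 0 x).2 ⟨id, refl h0, rfl⟩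
  rcases hirr.prime.dvd_or_dvd (hpq ▸ hdvd) with hd | hd
  · have h1 := evalEval_dvd 0 x' hd
    rw [hx', zero_dvd_iff, heval p _ (hp 0 h0)] at h1
    exact (hAmem 0 x').1 h1
  · have h1 := evalEval_dvd 0 x hd
    rw [hx, zero_dvd_iff, heval q _ (hq 0 h0)] at h1
    exact absurd hxA ((hA' 0 x (hmem hx)).1 h1)

theorem AnalyticAt.dslope_same {f : ℂ → ℂ} {c : ℂ} (hf : AnalyticAt ℂ f c) :
    AnalyticAt ℂ (dslope f c) c := by
  obtain ⟨p, hp⟩ := hf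
  exact ⟨_, hp.has_fpower_series_dslope_fslope⟩

theorem eq_add_mul_dslope (f : ℂ → ℂ) (c x : ℂ) : f x = f c + (x - c) * dslope f c x := by
  have := sub_smul_dslope f c x
  rw [smul_eq_mul] at this
  rw [this]
  ring

theorem AnalyticAt.exists_sq_eq {u : ℂ → ℂ} {c : ℂ} (hu : AnalyticAt ℂ u c) (h0 : u c ≠ 0) :
    ∃ v : ℂ → ℂ, AnalyticAt ℂ v c ∧ v c ≠ 0 ∧ ∀ x, v x ^ 2 = u x := by
  obtain ⟨a, ha⟩ := IsAlgClosed.exists_pow_nat_eq (u c) (n := 2) two_pos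
  have ha0 : a ≠ 0 := by
    rintro rfl
    exact h0 (by rw [← ha]; simp)
  have hv : ∀ x, (a * (u x / u c) ^ (((2 : ℕ) : ℂ)⁻¹)) ^ 2 = u x := fun x => by
    rw [mul_pow, ha, Complex.cpow_nat_inv_pow _ two_ne_zero, mul_div_cancel₀ _ h0]
  refine ⟨fun x => a * (u x / u c) ^ (((2 : ℕ) : ℂ)⁻¹), ?_, ?_, hv⟩
  · refine analyticAt_const.mul ((hu.div analyticAt_const h0).cpow analyticAt_const ?_)
    simp [div_self h0]
  · intro h
    refine h0 ?_
    rw [← hv c, pow_eq_zero_iff two_ne_zero]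
    exact h

namespace Polynomial

/-- Near an ordinary double root of `H t₁`, where the `t`-derivative does not vanish, the zero
locus of `H` is parametrized by a square root of `t - t₁`. -/
theorem exists_sqrt_parametrization {H : Polynomial (Polynomial ℂ)} {t₁ x₁ : ℂ}
    (hz : H.evalEval t₁ x₁ = 0) (hx : H.derivative.evalEval t₁ x₁ = 0)
    (hxx : H.derivative.derivative.evalEval t₁ x₁ ≠ 0)
    (ht : H.innerDerivative.evalEval t₁ x₁ ≠ 0) :
    ∃ lam κ : ℂ → ℂ, lam 0 = x₁ ∧ ∀ᶠ z in 𝓝 (0 : ℂ), ContinuousAt lam z ∧ κ (lam z) = z ∧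
      H.evalEval (t₁ + z ^ 2) (lam z) = 0 := by
  obtain ⟨θ, hθ, hθ0, hθH⟩ := exists_analyticAt_implicit (Bivariate.swap H) (t₀ := x₁) (x₀ := t₁)
    (by rwa [evalEval_swap]) (by
      rwa [innerDerivative, evalEval_swap] at ht)
  have hzero : ∀ᶠ x in 𝓝 x₁, H.evalEval (θ x) x = 0 := by
    have htend : Filter.Tendsto (fun x => (x, θ x)) (𝓝 x₁) (𝓝 (x₁, t₁)) := by
      have : ContinuousAt (fun x => (x, θ x)) x₁ := continuousAt_id.prodMk hθ.continuousAt
      simpa only [ContinuousAt, hθ0] using this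
    filter_upwards [htend.eventually hθH] with x hx
    have := hx.2 rfl
    rwa [evalEval_swap] at this
  have hderiv : ∀ᶠ x in 𝓝 x₁, H.innerDerivative.evalEval (θ x) x * deriv θ x +
      H.derivative.evalEval (θ x) x = 0 := by
    filter_upwards [hzero.eventually_nhds, hθ.eventually_analyticAt] with x hx1 hx2
    have h1 := H.hasDerivAt_evalEval_comp hx2.differentiableAt.hasDerivAt (hasDerivAt_id x)
    have h2 : HasDerivAt (fun s => H.evalEval (θ s) (id s)) 0 x :=
      (hasDerivAt_const x (0 : ℂ)).congr_of_eventuallyEq hx1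
    simpa using h1.unique h2
  have hθ' : deriv θ x₁ = 0 := by
    have := hderiv.self_of_nhds
    rw [hθ0, hx, add_zero, mul_eq_zero] at this
    exact this.resolve_left ht
  set u := dslope (dslope θ x₁) x₁ with hu
  have hua : AnalyticAt ℂ u x₁ := hθ.dslope_same.dslope_same
  have hθu : ∀ x, θ x = t₁ + (x - x₁) ^ 2 * u x := by
    intro x
    rw [eq_add_mul_dslope θ x₁ x, eq_add_mul_dslope (dslope θ x₁) x₁ x, dslope_same, hθ', hθ0]
    ring
  have hu0 : u x₁ ≠ 0 := by
    intro hu0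
    have h1 : HasDerivAt (fun x => H.derivative.evalEval (θ x) x)
        (H.derivative.derivative.evalEval t₁ x₁) x₁ := by
      have := H.derivative.hasDerivAt_evalEval_comp hθ.differentiableAt.hasDerivAt
        (hasDerivAt_id x₁)
      simpa [hθ', hθ0] using this
    have hθd : ∀ᶠ x in 𝓝 x₁, deriv θ x = (x - x₁) * (2 * u x + (x - x₁) * deriv u x) := by
      filter_upwards [hua.eventually_analyticAt] with x hx
      have h2 : HasDerivAt (fun x => t₁ + (x - x₁) ^ 2 * u x) _ x :=
        ((((hasDerivAt_id x).sub_const x₁).pow 2).mul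
          hx.differentiableAt.hasDerivAt).const_add t₁
      have hfun : θ = fun x => t₁ + (x - x₁) ^ 2 * u x := by
        funext x
        exact hθu x
      rw [congrArg (fun f => deriv f x) hfun, h2.deriv]
      simp
      ring
    have h3 : HasDerivAt (fun x => -(H.innerDerivative.evalEval (θ x) x *
        ((x - x₁) * (2 * u x + (x - x₁) * deriv u x)))) 0 x₁ := by
      have hi := H.innerDerivative.hasDerivAt_evalEval_comp hθ.differentiableAt.hasDerivAt
        (hasDerivAt_id x₁)
      have hs := (hasDerivAt_id x₁).sub_const x₁
      have := (hi.mul (hs.mul ((hua.differentiableAt.hasDerivAt.const_mul 2).add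
        (hs.mul hua.deriv.differentiableAt.hasDerivAt)))).neg
      refine this.congr_deriv ?_
      simp [hu0]
    refine hxx (h1.unique (h3.congr_of_eventuallyEq ?_))
    filter_upwards [hderiv, hθd] with x h4 h5
    rw [← h5]
    linear_combination h4
  obtain ⟨v, hva, hv0, hv⟩ := hua.exists_sq_eq hu0
  have hκ : HasStrictDerivAt (fun x => (x - x₁) * v x) (v x₁) x₁ := by
    have hs : HasStrictDerivAt (fun x : ℂ => x - x₁) 1 x₁ := (hasStrictDerivAt_id x₁).sub_const x₁
    have := hs.mul (hva.contDiffAt.hasStrictDerivAt (n := ω) (by simp))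
    refine this.congr_deriv ?_
    simp
  set κ : ℂ → ℂ := fun x => (x - x₁) * v x with hκdef
  set e := (hκ.hasStrictFDerivAt_equiv hv0).toOpenPartialHomeomorph κ with he
  have hsrc : x₁ ∈ e.source := (hκ.hasStrictFDerivAt_equiv hv0).mem_toOpenPartialHomeomorph_source
  have hecoe : ∀ x, e x = κ x := fun x => rfl
  have he1 : e x₁ = 0 := by rw [hecoe]; simp [hκdef]
  have hlam0 : e.symm 0 = x₁ := by rw [← he1]; exact e.left_inv hsrc
  have htgt : e.target ∈ 𝓝 (0 : ℂ) := e.open_target.mem_nhds (he1 ▸ e.map_source hsrc)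
  have hcont : ContinuousAt e.symm 0 := e.continuousAt_symm (mem_of_mem_nhds htgt)
  refine ⟨e.symm, κ, hlam0, ?_⟩
  have htend : Filter.Tendsto e.symm (𝓝 0) (𝓝 x₁) := by
    simpa only [ContinuousAt, hlam0] using hcont
  filter_upwards [htgt, htend.eventually hzero] with z hz1 hz2
  have h1 : κ (e.symm z) = z := e.right_inv hz1
  refine ⟨e.continuousAt_symm hz1, h1, ?_⟩
  have h2 : θ (e.symm z) = t₁ + z ^ 2 := by
    rw [hθu, ← hv]
    nth_rewrite 3 [← h1]
    simp only [hκdef]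
    ring
  rwa [h2] at hz2

end Polynomial

theorem Monodromy.of_indexed {B X ι : Type*} [TopologicalSpace B] [TopologicalSpace X]
    {S : B → Set X} {T : Set B} {b b' : B} (γ : Path b b') (hγ : ∀ s, γ s ∈ T)
    (P : ι → unitInterval → X) (hc : ∀ i, Continuous (P i)) (hS : ∀ i s, P i s ∈ S (γ s))
    (hinj : ∀ s i j, P i s = P j s → i = j) (hsurj : ∀ x ∈ S b, ∃ i, P i 0 = x)
    {σ : X → X} (hσ : ∀ i, σ (P i 0) = P i 1) : Monodromy S T b b' σ := by
  classical
  choose w hw using hsurj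
  refine ⟨γ, hγ, fun x s => if hx : x ∈ S b then P (w x hx) s else x, fun x hx => ?_, ?_⟩
  · simp only [hx, dif_pos]
    refine ⟨hc _, hw x hx, ?_, fun s => hS _ s⟩
    rw [← hσ, hw x hx]
  · intro s x hx y hy h
    simp only [hx, hy, dif_pos] at h
    have := hinj s _ _ h
    rw [← hw x hx, this, hw y hy]

namespace Polynomial

variable {H : Polynomial (Polynomial ℂ)}

theorem ncard_simple_roots_add_two (hH : H.Monic) {t₁ x₁ : ℂ} (hz : H.evalEval t₁ x₁ = 0)
    (hx : H.derivative.evalEval t₁ x₁ = 0) (hxx : H.derivative.derivative.evalEval t₁ x₁ ≠ 0)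
    (hsimple : ∀ q, H.evalEval t₁ q = 0 → q ≠ x₁ → H.derivative.evalEval t₁ q ≠ 0) :
    (H.fib t₁ \ {x₁}).ncard + 2 = H.natDegree := by
  classical
  set p := H.map (evalRingHom t₁)
  have hp : p ≠ 0 := hH.map_evalRingHom_ne_zero t₁
  have hmem : x₁ ∈ p.roots.toFinset := by
    rw [Multiset.mem_toFinset, mem_roots hp, IsRoot, map_evalRingHom_eval]
    exact hz
  have hset : H.fib t₁ \ {x₁} = ((p.roots.toFinset.erase x₁ : Finset ℂ) : Set ℂ) := by
    rw [fib_eq_roots hH, Finset.coe_erase]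
  rw [hset, Set.ncard_coe_finset, ← card_roots_map hH t₁, ← Multiset.toFinset_sum_count_eq,
    ← Finset.sum_erase_add _ _ hmem]
  congr 1
  · rw [Finset.card_eq_sum_ones]
    refine Finset.sum_congr rfl fun q hq => ?_
    obtain ⟨hq1, hq2⟩ := Finset.mem_erase.1 hq
    rw [Multiset.mem_toFinset, mem_roots hp, IsRoot, map_evalRingHom_eval] at hq2
    rw [count_roots, rootMultiplicity_eq_one hp]
    · rwa [map_evalRingHom_eval]
    · rw [derivative_map, map_evalRingHom_eval]
      exact hsimple q hq2 hq1
  · rw [count_roots, rootMultiplicity_eq_two hp]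
    · rwa [map_evalRingHom_eval]
    · rwa [derivative_map, map_evalRingHom_eval]
    · rwa [derivative_map, derivative_map, map_evalRingHom_eval]

end Polynomial

open Polynomial in
/-- An ordinary branch point of a monic polynomial gives rise to a transposition in its monodromy
group, of two roots of the factor that branches. -/
theorem Monodromy.exists_swap {H h g : Polynomial (Polynomial ℂ)} (hH : H.Monic) (hHg : H = h * g)
    (h0 : (0 : ℂ) ∈ H.regularSet) {t₁ x₁ : ℂ} (hh : h.evalEval t₁ x₁ = 0)
    (hx : H.derivative.evalEval t₁ x₁ = 0)
    (hxx : H.derivative.derivative.evalEval t₁ x₁ ≠ 0)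
    (ht : H.innerDerivative.evalEval t₁ x₁ ≠ 0)
    (hsimple : ∀ q, H.evalEval t₁ q = 0 → q ≠ x₁ → H.derivative.evalEval t₁ q ≠ 0) :
    ∃ x x', x ≠ x' ∧ h.evalEval 0 x = 0 ∧ h.evalEval 0 x' = 0 ∧
      Monodromy H.fib H.regularSet 0 0 (Equiv.swap x x') := by
  have hz : H.evalEval t₁ x₁ = 0 := by rw [hHg, evalEval_mul, hh, zero_mul]
  have hg : g.evalEval t₁ x₁ ≠ 0 := by
    intro hg
    refine ht ((H.hasDerivAt_evalEval_left t₁ x₁).unique ?_)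
    have := (h.hasDerivAt_evalEval_left t₁ x₁).mul (g.hasDerivAt_evalEval_left t₁ x₁)
    rw [hh, hg, mul_zero, zero_mul, add_zero] at this
    refine this.congr_of_eventuallyEq (Filter.Eventually.of_forall fun t => ?_)
    simp [hHg]
  obtain ⟨lam, κ, hlam0, hlam⟩ := exists_sqrt_parametrization hz hx hxx ht
  set W := H.fib t₁ \ {x₁} with hW
  have hWfin : W.Finite := (fib_finite hH t₁).subset Set.sdiff_subset
  obtain ⟨φ, hφ0, hφ⟩ := exists_eventually_sections (H := H) (t₀ := t₁) (W := W) hWfin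
    (fun x hx => hx.1) (fun x hx => hsimple x hx.1 hx.2)
  have hsq : Filter.Tendsto (fun z : ℂ => t₁ + z ^ 2) (𝓝 0) (𝓝 t₁) := by
    have : Continuous fun z : ℂ => t₁ + z ^ 2 := by fun_prop
    simpa using this.tendsto 0
  have hlamc : ContinuousAt lam 0 := hlam.self_of_nhds.1
  have hU : ∀ᶠ z in 𝓝 (0 : ℂ), z ≠ 0 → t₁ + z ^ 2 ∈ H.regularSet := by
    have : ((H.regularSetᶜ \ {t₁})ᶜ) ∈ 𝓝 t₁ :=
      ((finite_compl_regularSet hH h0).subset Set.sdiff_subset).isClosed.isOpen_compl.mem_nhds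
        (by simp)
    filter_upwards [hsq.eventually this] with z hz1 hz0
    by_contra hcon
    exact hz1 ⟨hcon, by simpa using hz0⟩
  have hne : ∀ᶠ z in 𝓝 (0 : ℂ), ∀ w ∈ W, φ w (t₁ + z ^ 2) ≠ lam z := by
    refine (Set.Finite.eventually_all hWfin).2 fun w hw => ?_
    have h1 : ContinuousAt (fun z : ℂ => φ w (t₁ + z ^ 2)) 0 := by
      have h2 : ContinuousAt (φ w) (t₁ + 0 ^ 2) := by
        simpa using (hφ.self_of_nhds.1 w hw).1.continuousAt
      exact ContinuousAt.comp (f := fun z : ℂ => t₁ + z ^ 2) h2 (by fun_prop)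
    have h3 : φ w (t₁ + 0 ^ 2) - lam 0 ≠ 0 := by
      rw [zero_pow two_ne_zero, add_zero, hφ0 w hw, hlam0, sub_ne_zero]
      exact hw.2
    filter_upwards [(h1.sub hlamc).eventually_ne h3] with z hz
    exact sub_ne_zero.1 hz
  have hgz : ∀ᶠ z in 𝓝 (0 : ℂ), g.evalEval (t₁ + z ^ 2) (lam z) ≠ 0 := by
    have h1 : ContinuousAt (fun z : ℂ => (t₁ + z ^ 2, lam z)) 0 :=
      ContinuousAt.prodMk (by fun_prop) hlamc
    have h2 : ContinuousAt (fun z : ℂ => g.evalEval (t₁ + z ^ 2) (lam z)) 0 :=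
      ContinuousAt.comp (g := fun z : ℂ × ℂ => g.evalEval z.1 z.2)
        (f := fun z : ℂ => (t₁ + z ^ 2, lam z)) (continuous_evalEval g).continuousAt h1
    exact h2.eventually_ne (by simpa [hlam0] using hg)
  obtain ⟨r, hr, hball⟩ := Metric.eventually_nhds_iff_ball.1
    (hlam.and ((hsq.eventually hφ).and (hU.and (hne.and hgz))))
  set ε : ℂ := ((r / 2 : ℝ) : ℂ) with hε
  have hεn : ‖ε‖ = r / 2 := by rw [hε, Complex.norm_real, Real.norm_of_nonneg (by linarith)]
  have hε0 : ε ≠ 0 := by rw [← norm_ne_zero_iff, hεn]; linarith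
  let sg : Bool → ℂ := fun b => if b then 1 else -1
  have hsg2 : ∀ b, sg b ^ 2 = 1 := fun b => by cases b <;> simp [sg]
  have hsgn : ∀ b, ‖sg b‖ = 1 := fun b => by cases b <;> simp [sg]
  have hsginj : ∀ b c, sg b = sg c → b = c := by
    intro b c
    cases b <;> cases c <;> simp [sg, eq_neg_iff_add_eq_zero, neg_eq_iff_add_eq_zero]
  let ζ : unitInterval → ℂ := fun s => ε * Complex.exp (Real.pi * Complex.I * (s : ℝ))
  have hζc : Continuous ζ := by fun_prop
  have hζn : ∀ s, ‖ζ s‖ = r / 2 := fun s => by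
    have : (Real.pi * Complex.I * (s : ℝ) : ℂ) = ((Real.pi * (s : ℝ) : ℝ) : ℂ) * Complex.I := by
      push_cast; ring
    simp only [ζ]
    rw [norm_mul, hεn, this, Complex.norm_exp_ofReal_mul_I, mul_one]
  have hζ0 : ζ 0 = ε := by simp [ζ]
  have hζ1 : ζ 1 = -ε := by simp [ζ, Complex.exp_pi_mul_I]
  have hmem : ∀ b s, sg b * ζ s ∈ Metric.ball (0 : ℂ) r := fun b s => by
    rw [mem_ball_zero_iff, norm_mul, hsgn, one_mul, hζn]
    linarith
  have hmem' : ∀ s, ζ s ∈ Metric.ball (0 : ℂ) r := fun s => by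
    simpa [sg] using hmem true s
  have hζne : ∀ s, ζ s ≠ 0 := fun s => by
    rw [← norm_ne_zero_iff, hζn]; linarith
  have hsq' : ∀ b s, t₁ + (sg b * ζ s) ^ 2 = t₁ + ζ s ^ 2 := fun b s => by
    rw [mul_pow, hsg2, one_mul]
  let γ : Path (t₁ + ε ^ 2) (t₁ + ε ^ 2) :=
    ⟨⟨fun s => t₁ + ζ s ^ 2, by fun_prop⟩, by simp [hζ0], by simp [hζ1]⟩
  have hγapp : ∀ s, γ s = t₁ + ζ s ^ 2 := fun s => rfl
  let P : W ⊕ Bool → unitInterval → ℂ :=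
    Sum.elim (fun w s => φ w (t₁ + ζ s ^ 2)) (fun b s => lam (sg b * ζ s))
  have hPS : ∀ i s, P i s ∈ H.fib (γ s) := by
    rintro (w | b) s
    · exact ((hball _ (hmem' s)).2.1.1 w w.2).2.1
    · have := (hball _ (hmem b s)).1.2.2
      rwa [hsq'] at this
  have hPinj : ∀ s i j, P i s = P j s → i = j := by
    rintro s (w | b) (w' | b') hij
    · exact congrArg _ (Subtype.ext ((hball _ (hmem' s)).2.1.2 w.2 w'.2 hij))
    · refine absurd hij ?_
      have := (hball _ (hmem b' s)).2.2.2.1 w w.2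
      rwa [hsq'] at this
    · refine absurd hij.symm ?_
      have := (hball _ (hmem b s)).2.2.2.1 w' w'.2
      rwa [hsq'] at this
    · have h1 := congrArg κ hij
      simp only [P, Sum.elim_inr] at h1
      rw [(hball _ (hmem b s)).1.2.1, (hball _ (hmem b' s)).1.2.1] at h1
      rw [hsginj b b' (mul_right_cancel₀ (hζne s) h1)]
  have hγU : ∀ s, γ s ∈ H.regularSet := fun s => (hball _ (hmem' s)).2.2.1 (hζne s)
  have hPsurj : ∀ x ∈ H.fib (t₁ + ε ^ 2), ∃ i, P i 0 = x := by
    have hsub : Set.range (fun i => P i 0) ⊆ H.fib (t₁ + ε ^ 2) := by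
      rintro _ ⟨i, rfl⟩
      simpa using hPS i 0
    have hfinW : Finite W := hWfin
    have hcard : (Set.range (fun i => P i 0)).ncard = H.natDegree := by
      rw [← Set.image_univ, Set.ncard_image_of_injective _ (fun i j h => hPinj 0 i j h),
        Set.ncard_univ, Nat.card_sum, Nat.card_coe_set_eq,
        ← ncard_simple_roots_add_two hH hz hx hxx hsimple]
      simp [hW]
    have := Set.eq_of_subset_of_ncard_le hsub (by rw [hcard]; exact ncard_fib_le hH _)
      (fib_finite hH _)
    intro x hx
    rwa [← this] at hx
  have hmon : Monodromy H.fib H.regularSet (t₁ + ε ^ 2) (t₁ + ε ^ 2)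
      (Equiv.swap (lam ε) (lam (-ε))) := by
    refine Monodromy.of_indexed γ hγU P ?_ hPS hPinj hPsurj ?_
    · rintro (w | b)
      · refine continuous_iff_continuousAt.2 fun s => ?_
        refine ContinuousAt.comp (g := φ w) (f := fun s => t₁ + ζ s ^ 2) ?_ (by fun_prop)
        exact ((hball _ (hmem' s)).2.1.1 w w.2).1.continuousAt
      · refine continuous_iff_continuousAt.2 fun s => ?_
        exact ContinuousAt.comp (g := lam) (f := fun s => sg b * ζ s)
          (hball _ (hmem b s)).1.1 (by fun_prop)
    · have hl1 : lam ε = P (Sum.inr true) 0 := by simp [P, sg, hζ0]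
      have hl2 : lam (-ε) = P (Sum.inr false) 0 := by simp [P, sg, hζ0]
      rintro (w | b)
      · rw [Equiv.swap_apply_of_ne_of_ne]
        · simp [P, hζ0, hζ1]
        · rw [hl1]
          intro h
          cases hPinj _ _ _ h
        · rw [hl2]
          intro h
          cases hPinj _ _ _ h
      · cases b <;> simp [P, sg, hζ0, hζ1]
  have hεmem : ∀ b, sg b * ε ∈ Metric.ball (0 : ℂ) r := fun b => by simpa [hζ0] using hmem b 0
  have hroot : ∀ b, h.evalEval (t₁ + ε ^ 2) (lam (sg b * ε)) = 0 := fun b => by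
    obtain ⟨⟨-, -, h1⟩, -, -, -, h2⟩ := hball _ (hεmem b)
    rw [mul_pow, hsg2, one_mul] at h1 h2
    rw [hHg, evalEval_mul] at h1
    exact (mul_eq_zero.1 h1).resolve_right h2
  have hr1 : h.evalEval (t₁ + ε ^ 2) (lam ε) = 0 := by simpa [sg] using hroot true
  have hr2 : h.evalEval (t₁ + ε ^ 2) (lam (-ε)) = 0 := by simpa [sg] using hroot false
  have hf : ∀ {t x}, h.evalEval t x = 0 → x ∈ H.fib t := fun {t x} hx => by
    rw [mem_fib, hHg, evalEval_mul, hx, zero_mul]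
  obtain ⟨ρ, hρ⟩ := exists_of_mem_regularSet hH h0
    (show t₁ + ε ^ 2 ∈ H.regularSet by simpa using hγU 0) h0
  refine ⟨ρ (lam ε), ρ (lam (-ε)), fun hcon => ?_, ?_, ?_, ?_⟩
  · have h1 := congrArg κ (hρ.injOn (hf hr1) (hf hr2) hcon)
    have h2 := (hball _ (hεmem true)).1.2.1
    have h3 := (hball _ (hεmem false)).1.2.1
    simp only [sg, if_true, one_mul, Bool.false_eq_true, if_false, neg_mul] at h2 h3
    rw [h2, h3] at h1
    exact hε0 (by simpa using self_eq_neg.1 h1)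
  · exact (evalEval_eq_zero_iff hHg hρ (hf hr1)).2 hr1
  · exact (evalEval_eq_zero_iff hHg hρ (hf hr2)).2 hr2
  · exact hρ.conj_swap (fib_finite hH 0)
      (by rw [ncard_fib hH h0, ncard_fib hH hρ.source_mem]) (hf hr1) (hf hr2) hmon

theorem Set.Countable.image_of_locally {X Y : Type*} [TopologicalSpace X]
    [SecondCountableTopology X] {A : Set X} (π : X → Y)
    (h : ∀ x ∈ A, ∃ N ∈ 𝓝 x, (π '' (A ∩ N)).Countable) : (π '' A).Countable := by
  choose! N hN hc using h
  obtain ⟨t, htA, ht, hcov⟩ := TopologicalSpace.countable_cover_nhdsWithin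
    (fun x hx => mem_nhdsWithin_of_mem_nhds (hN x hx))
  refine (ht.biUnion fun x hx => hc x (htA hx)).mono ?_
  rintro _ ⟨x, hx, rfl⟩
  obtain ⟨y, hy, hxy⟩ := Set.mem_iUnion₂.1 (hcov hx)
  exact Set.mem_iUnion₂.2 ⟨y, hy, x, ⟨hx, hxy⟩, rfl⟩

theorem countable_simple_zeros (u u' : ℂ → ℂ) :
    {s | u s = 0 ∧ HasDerivAt u (u' s) s ∧ u' s ≠ 0}.Countable := by
  rw [← Set.image_id {s | u s = 0 ∧ HasDerivAt u (u' s) s ∧ u' s ≠ 0}]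
  refine Set.Countable.image_of_locally id fun s hs => ?_
  have := (hs.2.1.eventually_ne (c := 0) hs.2.2)
  rw [eventually_nhdsWithin_iff] at this
  refine ⟨_, this, (Set.countable_singleton s).mono ?_⟩
  rintro _ ⟨x, ⟨hx, hx'⟩, rfl⟩
  by_contra hne
  exact hx' hne hx.1

namespace Polynomial

variable {h g f : Polynomial (Polynomial ℂ)}

theorem evalEval_eval_affine (f : Polynomial (Polynomial ℂ)) (c w q : ℂ) :
    (f.eval (C c + C w * X)).eval q = f.evalEval q (c + w * q) := by
  have : f.evalEval q (c + w * q) = f.eval₂ (evalRingHom q) (evalRingHom q (C c + C w * X)) := by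
    rw [← map_evalRingHom_eval, eval_map]
    simp
  rw [this, ← coe_evalRingHom, ← eval₂_id (x := C c + C w * X), hom_eval₂, RingHom.comp_id]

theorem exists_curved_section (hf : f.Monic) (hirr : Irreducible h) (hdvd : f = h * g)
    (hdeg : 2 ≤ h.natDegree) (h0 : (0 : ℂ) ∈ f.regularSet) :
    ∃ (φ : ℂ → ℂ) (D : Set ℂ), IsOpen D ∧ D.Nonempty ∧ ∀ t ∈ D, AnalyticAt ℂ φ t ∧
      h.evalEval t (φ t) = 0 ∧ f.derivative.evalEval t (φ t) ≠ 0 ∧ deriv (deriv φ) t ≠ 0 := by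
  have hunit : IsUnit h.leadingCoeff := by
    refine IsUnit.of_mul_eq_one g.leadingCoeff ?_
    rw [← leadingCoeff_mul, ← hdvd, hf.leadingCoeff]
  have hdeg0 : (h.map (evalRingHom (0 : ℂ))).degree ≠ 0 := by
    rw [degree_map_eq_of_leadingCoeff_ne_zero _ (hunit.map _).ne_zero]
    intro hd
    have := natDegree_eq_of_degree_eq_some (n := 0) hd
    omega
  obtain ⟨x₀, hx₀⟩ := IsAlgClosed.exists_root _ hdeg0
  rw [IsRoot, map_evalRingHom_eval] at hx₀
  obtain ⟨ψ, hψ0, hψ⟩ := exists_eventually_sections (H := f) (W := {x₀}) (Set.finite_singleton _)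
    (fun x hx => by rw [Set.mem_singleton_iff.1 hx, hdvd, evalEval_mul, hx₀, zero_mul])
    (fun x hx => h0 x (by rw [Set.mem_singleton_iff.1 hx, hdvd, evalEval_mul, hx₀, zero_mul]))
  set φ := ψ x₀
  have hφ0 : φ 0 = x₀ := hψ0 x₀ rfl
  have hφ : ∀ᶠ t in 𝓝 (0 : ℂ), AnalyticAt ℂ φ t ∧ f.evalEval t (φ t) = 0 ∧
      f.derivative.evalEval t (φ t) ≠ 0 := hψ.mono fun t ht => ht.1 x₀ rfl
  have hg : ∀ᶠ t in 𝓝 (0 : ℂ), g.evalEval t (φ t) ≠ 0 := by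
    have h1 : ContinuousAt (fun t => (t, φ t)) (0 : ℂ) :=
      continuousAt_id.prodMk hφ.self_of_nhds.1.continuousAt
    have h2 : ContinuousAt (fun t => g.evalEval t (φ t)) (0 : ℂ) :=
      ContinuousAt.comp (g := fun z : ℂ × ℂ => g.evalEval z.1 z.2) (f := fun t => (t, φ t))
        (continuous_evalEval g).continuousAt h1
    refine h2.eventually_ne fun hg => h0 x₀ ?_ ?_
    · rw [hdvd, evalEval_mul, hx₀, zero_mul]
    · rw [hφ0] at hg
      rw [hdvd, derivative_mul, evalEval_add, evalEval_mul, evalEval_mul, hx₀, hg]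
      simp
  obtain ⟨r, hr, hball⟩ := Metric.eventually_nhds_iff_ball.1 (hφ.and hg)
  have hh : ∀ t ∈ Metric.ball (0 : ℂ) r, h.evalEval t (φ t) = 0 := fun t ht => by
    have h1 := (hball t ht).1.2.1
    rw [hdvd, evalEval_mul] at h1
    exact (mul_eq_zero.1 h1).resolve_right (hball t ht).2
  have han : ∀ t ∈ Metric.ball (0 : ℂ) r, AnalyticAt ℂ φ t := fun t ht => (hball t ht).1.1
  have hcurv : ∃ t ∈ Metric.ball (0 : ℂ) r, deriv (deriv φ) t ≠ 0 := by
    by_contra! hcon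
    have hpre : IsPreconnected (Metric.ball (0 : ℂ) r) := (convex_ball 0 r).isPreconnected
    obtain ⟨w, hw⟩ := Metric.isOpen_ball.exists_is_const_of_deriv_eq_zero hpre
      (fun t ht => (han t ht).deriv.differentiableAt.differentiableWithinAt) hcon
    have hlin : Set.EqOn φ (fun t => φ 0 + w * t) (Metric.ball 0 r) := by
      refine Metric.isOpen_ball.eqOn_of_deriv_eq hpre
        (fun t ht => (han t ht).differentiableAt.differentiableWithinAt)
        (by fun_prop) (fun t ht => ?_) (Metric.mem_ball_self hr) (by simp)
      rw [hw t ht]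
      simp
    have hzero : h.eval (C (φ 0) + C w * X) = 0 := by
      refine eq_zero_of_infinite_isRoot _ ((infinite_of_mem_nhds (0 : ℂ)
        (Metric.ball_mem_nhds _ hr)).mono fun t ht => ?_)
      rw [Set.mem_ofPred_eq, IsRoot, evalEval_eval_affine]
      have := hh t ht
      rwa [hlin ht] at this
    have := natDegree_eq_of_degree_eq_some (n := 1)
      (degree_eq_one_of_irreducible_of_root hirr hzero)
    omega
  obtain ⟨t₁, ht₁, hne⟩ := hcurv
  have hev : ∀ᶠ t in 𝓝 t₁, deriv (deriv φ) t ≠ 0 :=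
    (han t₁ ht₁).deriv.deriv.continuousAt.eventually_ne hne
  obtain ⟨D, hD, hDo, htD⟩ := eventually_nhds_iff.1
    (hev.and (Metric.isOpen_ball.mem_nhds ht₁))
  exact ⟨φ, D, hDo, ⟨t₁, htD⟩, fun t ht => ⟨han t (hD t ht).2, hh t (hD t ht).2,
    (hball t (hD t ht).2).1.2.2, (hD t ht).1⟩⟩

end Polynomial

/-- A tangent line of a curved graph is locally determined among the tangent lines of the graph
that are also tangent to another graph elsewhere. -/
theorem eventually_eq_of_bitangent {φ χ : ℂ → ℂ} {s₀ q₀ : ℂ} (hφ : AnalyticAt ℂ φ s₀)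
    (hφ2 : deriv (deriv φ) s₀ ≠ 0) (hχ : AnalyticAt ℂ χ q₀) (hne : q₀ ≠ s₀)
    (hslope : deriv χ q₀ = deriv φ s₀) :
    ∀ᶠ z : ℂ × ℂ in 𝓝 (s₀, q₀), deriv χ z.2 = deriv φ z.1 →
      χ z.2 = φ z.1 + deriv φ z.1 * (z.2 - z.1) → z.1 = s₀ := by
  have hst : HasStrictDerivAt (deriv φ) (deriv (deriv φ) s₀) s₀ := hφ.deriv.hasStrictDerivAt
  set κ := hst.localInverse _ _ _ hφ2 with hκ
  have hκa : AnalyticAt ℂ κ (deriv φ s₀) := hφ.deriv.analyticAt_localInverse hφ2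
  have hleft : ∀ᶠ s in 𝓝 s₀, κ (deriv φ s) = s := hst.eventually_left_inverse hφ2
  have hright : ∀ᶠ w in 𝓝 (deriv φ s₀), deriv φ (κ w) = w := hst.eventually_right_inverse hφ2
  set ρ := fun q => κ (deriv χ q) with hρ
  have hρ0 : ρ q₀ = s₀ := by simp only [hρ, hslope]; exact hleft.self_of_nhds
  have hρa : AnalyticAt ℂ ρ q₀ := by
    rw [← hslope] at hκa
    exact hκa.comp hχ.deriv
  have hρφ : ∀ᶠ q in 𝓝 q₀, deriv φ (ρ q) = deriv χ q := by
    have := hχ.deriv.continuousAt.tendsto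
    rw [hslope] at this
    exact this.eventually hright
  set e := fun q => χ q - (φ (ρ q) + deriv χ q * (q - ρ q)) with he
  have hea : AnalyticAt ℂ e q₀ := by
    have h1 : AnalyticAt ℂ (fun q => φ (ρ q)) q₀ := by
      rw [← hρ0] at hφ
      exact hφ.comp hρa
    exact hχ.sub (h1.add (hχ.deriv.mul (analyticAt_id.sub hρa)))
  have hfst : Filter.Tendsto Prod.fst (𝓝 (s₀, q₀)) (𝓝 s₀) := continuous_fst.tendsto _
  have hsnd : Filter.Tendsto Prod.snd (𝓝 (s₀, q₀)) (𝓝 q₀) := continuous_snd.tendsto _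
  suffices h : ∀ᶠ q in 𝓝 q₀, e q = 0 → ρ q = s₀ by
    filter_upwards [hsnd.eventually h, hfst.eventually hleft] with z hz1 hz2 h1 h2
    have h3 : ρ z.2 = z.1 := by simp only [hρ, h1, hz2]
    rw [← h3]
    refine hz1 ?_
    simp only [he, h3, h1, h2, sub_self]
  rcases hea.eventually_eq_zero_or_eventually_ne_zero with h | h
  · have hderiv : ∀ᶠ q in 𝓝 q₀, deriv (deriv χ) q = 0 := by
      have hφρ : ∀ᶠ q in 𝓝 q₀, AnalyticAt ℂ φ (ρ q) := by
        have := hρa.continuousAt.tendsto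
        rw [hρ0] at this
        exact this.eventually hφ.eventually_analyticAt
      have hneq : ∀ᶠ q in 𝓝 q₀, q - ρ q ≠ 0 :=
        (continuousAt_id.sub hρa.continuousAt).eventually_ne (by simpa [hρ0, sub_eq_zero] using hne)
      filter_upwards [h.eventually_nhds, hρφ, hρa.eventually_analyticAt,
        hχ.eventually_analyticAt, hφρ, hneq] with q h1 h2 h3 h4 h5 h6
      have hd1 : HasDerivAt e 0 q := (hasDerivAt_const q (0 : ℂ)).congr_of_eventuallyEq h1
      have hφc : HasDerivAt (fun q => φ (ρ q)) (deriv φ (ρ q) * deriv ρ q) q :=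
        h5.differentiableAt.hasDerivAt.comp q h3.differentiableAt.hasDerivAt
      have hd2 := h4.differentiableAt.hasDerivAt.sub (hφc.add
        (h4.deriv.differentiableAt.hasDerivAt.mul
          ((hasDerivAt_id q).sub h3.differentiableAt.hasDerivAt)))
      have := hd2.unique hd1
      rw [h2, Pi.sub_apply, id] at this
      refine (mul_eq_zero.1 (?_ : deriv (deriv χ) q * (q - ρ q) = 0)).resolve_right h6
      linear_combination -this
    obtain ⟨r, hr, hball⟩ := Metric.eventually_nhds_iff_ball.1
      (hderiv.and hχ.eventually_analyticAt)
    filter_upwards [Metric.ball_mem_nhds q₀ hr] with q hq _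
    obtain ⟨w, hw⟩ := Metric.isOpen_ball.exists_is_const_of_deriv_eq_zero
      (convex_ball q₀ r).isPreconnected
      (fun t ht => (hball t ht).2.deriv.differentiableAt.differentiableWithinAt)
      (fun t ht => (hball t ht).1)
    rw [← hρ0]
    simp only [hρ]
    rw [hw q hq, hw q₀ (Metric.mem_ball_self hr)]
  · rw [eventually_nhdsWithin_iff] at h
    filter_upwards [h] with q hq he
    by_contra hcon
    refine hq ?_ he
    rintro rfl
    exact hcon hρ0

namespace Polynomial

variable {h g f : Polynomial (Polynomial ℂ)}

theorem hasDerivAt_eval_affine (f : Polynomial (Polynomial ℂ)) (c w q : ℂ) :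
    HasDerivAt (fun q => f.evalEval q (c + w * q))
      (f.innerDerivative.evalEval q (c + w * q) + w * f.derivative.evalEval q (c + w * q)) q := by
  have h1 : HasDerivAt (fun q : ℂ => c + w * q) w q := by
    simpa using ((hasDerivAt_id q).const_mul w).const_add c
  refine (f.hasDerivAt_evalEval_comp (hasDerivAt_id q) h1).congr_deriv ?_
  simp only [id]
  ring

theorem derivative_eval_affine (f : Polynomial (Polynomial ℂ)) (c w : ℂ) :
    (f.eval (C c + C w * X)).derivative =
      (f.innerDerivative + C (C w) * f.derivative).eval (C c + C w * X) := by
  refine funext fun q => ?_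
  have h1 := (f.eval (C c + C w * X)).hasDerivAt q
  simp only [evalEval_eval_affine] at h1 ⊢
  rw [h1.unique (f.hasDerivAt_eval_affine c w q)]
  simp [evalEval_add, evalEval_mul]

theorem eval_derivative_eval_affine (f : Polynomial (Polynomial ℂ)) (c w q : ℂ) :
    (f.eval (C c + C w * X)).derivative.eval q =
      f.innerDerivative.evalEval q (c + w * q) + w * f.derivative.evalEval q (c + w * q) := by
  rw [derivative_eval_affine, evalEval_eval_affine]
  simp [evalEval_add, evalEval_mul]

theorem countable_bitangent {φ : ℂ → ℂ} {D : Set ℂ}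
    (hφ : ∀ t ∈ D, AnalyticAt ℂ φ t ∧ deriv (deriv φ) t ≠ 0) :
    {s ∈ D | ∃ q ∈ f.regularSet, q ≠ s ∧ f.evalEval q (φ s + deriv φ s * (q - s)) = 0 ∧
      f.innerDerivative.evalEval q (φ s + deriv φ s * (q - s)) +
        deriv φ s * f.derivative.evalEval q (φ s + deriv φ s * (q - s)) = 0}.Countable := by
  set A : Set (ℂ × ℂ) := {z | z.1 ∈ D ∧ z.2 ∈ f.regularSet ∧ z.2 ≠ z.1 ∧
    f.evalEval z.2 (φ z.1 + deriv φ z.1 * (z.2 - z.1)) = 0 ∧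
      f.innerDerivative.evalEval z.2 (φ z.1 + deriv φ z.1 * (z.2 - z.1)) +
        deriv φ z.1 * f.derivative.evalEval z.2 (φ z.1 + deriv φ z.1 * (z.2 - z.1)) = 0} with hA
  suffices h : (Prod.fst '' A).Countable by
    refine h.mono ?_
    rintro s ⟨hs, q, hq⟩
    exact ⟨(s, q), ⟨hs, hq⟩, rfl⟩
  refine Set.Countable.image_of_locally _ ?_
  rintro ⟨s₀, q₀⟩ ⟨hs, hq, hne, hz, hd⟩
  simp only at hs hq hne hz hd
  obtain ⟨hφa, hφ2⟩ := hφ s₀ hs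
  set r₀ := φ s₀ + deriv φ s₀ * (q₀ - s₀) with hr₀
  have hfy := hq _ hz
  obtain ⟨χ, hχ, hχ0, hχf⟩ := f.exists_analyticAt_implicit hz hfy
  have hcur : ContinuousAt (fun q => (q, χ q)) q₀ := continuousAt_id.prodMk hχ.continuousAt
  have htend : Filter.Tendsto (fun q => (q, χ q)) (𝓝 q₀) (𝓝 (q₀, r₀)) := by
    have := hcur.tendsto
    rwa [hχ0] at this
  have hχd : ∀ᶠ q in 𝓝 q₀, f.innerDerivative.evalEval q (χ q) +
      f.derivative.evalEval q (χ q) * deriv χ q = 0 := by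
    filter_upwards [(htend.eventually hχf).eventually_nhds, hχ.eventually_analyticAt] with q h1 h2
    have h3 := f.hasDerivAt_evalEval_comp (hasDerivAt_id q) h2.differentiableAt.hasDerivAt
    have h4 : HasDerivAt (fun q => f.evalEval (id q) (χ q)) 0 q :=
      (hasDerivAt_const q (0 : ℂ)).congr_of_eventuallyEq (h1.mono fun q hq => hq.2 rfl)
    simpa using h3.unique h4
  have hfy' : ∀ᶠ q in 𝓝 q₀, f.derivative.evalEval q (χ q) ≠ 0 := by
    have : ContinuousAt (fun q => f.derivative.evalEval q (χ q)) q₀ :=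
      ContinuousAt.comp (g := fun z : ℂ × ℂ => f.derivative.evalEval z.1 z.2)
        (f := fun t => (t, χ t)) (continuous_evalEval _).continuousAt hcur
    exact this.eventually_ne (by rwa [hχ0])
  have hslope : ∀ {q s}, f.innerDerivative.evalEval q (χ q) +
      f.derivative.evalEval q (χ q) * deriv χ q = 0 → f.derivative.evalEval q (χ q) ≠ 0 →
      f.innerDerivative.evalEval q (χ q) + deriv φ s * f.derivative.evalEval q (χ q) = 0 →
      deriv χ q = deriv φ s := by
    intro q s h1 h2 h3
    refine mul_left_cancel₀ h2 ?_
    linear_combination h1 - h3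
  have hcont : ContinuousAt (fun z : ℂ × ℂ => (z.2, φ z.1 + deriv φ z.1 * (z.2 - z.1)))
      (s₀, q₀) := by
    have h1 : ContinuousAt (fun z : ℂ × ℂ => φ z.1) (s₀, q₀) :=
      ContinuousAt.comp (g := φ) (f := Prod.fst) hφa.continuousAt continuousAt_fst
    have h2 : ContinuousAt (fun z : ℂ × ℂ => deriv φ z.1) (s₀, q₀) :=
      ContinuousAt.comp (g := deriv φ) (f := Prod.fst) hφa.deriv.continuousAt continuousAt_fst
    fun_prop
  have hsnd : Filter.Tendsto Prod.snd (𝓝 (s₀, q₀)) (𝓝 q₀) := continuous_snd.tendsto _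
  have hbit := eventually_eq_of_bitangent hφa hφ2 hχ hne
    (hslope hχd.self_of_nhds hfy'.self_of_nhds (by rwa [hχ0]))
  refine ⟨_, hbit.and ((hcont.tendsto.eventually hχf).and
    (hsnd.eventually (hχd.and hfy'))), (Set.countable_singleton s₀).mono ?_⟩
  rintro _ ⟨⟨s, q⟩, ⟨⟨-, -, -, hz', hd'⟩, h1, h2, h3, h4⟩, rfl⟩
  simp only at h1 h2 h3 h4 hz' hd' ⊢
  have h5 := h2.1 hz'
  rw [← h5] at hd'
  exact h1 (hslope h3 h4 hd') h5

end Polynomial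

namespace Polynomial

variable {h g f : Polynomial (Polynomial ℂ)}

/-- A curve without vertical asymptotes has, along each of its nonlinear components, an ordinary
tangent line that meets the curve transversally away from the point of tangency. The line can be
chosen off the origin and off finitely many slopes. -/
theorem exists_simple_tangent (hf : f.Monic) (hirr : Irreducible h) (hdvd : f = h * g)
    (hdeg : 2 ≤ h.natDegree) (h0 : (0 : ℂ) ∈ f.regularSet) {Q : Polynomial ℂ} (hQ : Q ≠ 0) :
    ∃ s c w : ℂ, c ≠ 0 ∧ Q.eval w ≠ 0 ∧ h.evalEval s (c + w * s) = 0 ∧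
      f.derivative.evalEval s (c + w * s) ≠ 0 ∧
      (f.eval (C c + C w * X)).derivative.eval s = 0 ∧
      (f.eval (C c + C w * X)).derivative.derivative.eval s ≠ 0 ∧
      ∀ q ≠ s, (f.eval (C c + C w * X)).eval q = 0 →
        (f.eval (C c + C w * X)).derivative.eval q ≠ 0 := by
  obtain ⟨φ, D, hDo, hDne, hD⟩ := exists_curved_section hf hirr hdvd hdeg h0
  have hφd : ∀ {s}, s ∈ D → HasDerivAt φ (deriv φ s) s := fun hs =>
    (hD _ hs).1.differentiableAt.hasDerivAt
  have hφdd : ∀ {s}, s ∈ D → HasDerivAt (deriv φ) (deriv (deriv φ) s) s := fun hs =>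
    (hD _ hs).1.deriv.differentiableAt.hasDerivAt
  have hb1 := countable_bitangent (f := f) (φ := φ) (D := D) fun t ht =>
    ⟨(hD t ht).1, (hD t ht).2.2.2⟩
  have hb2 : {s ∈ D | ∃ q ∈ f.regularSetᶜ, q ≠ s ∧
      f.evalEval q (φ s + deriv φ s * (q - s)) = 0}.Countable := by
    have hc : (⋃ q ∈ f.regularSetᶜ, ⋃ r ∈ f.fib q,
        {s | φ s + deriv φ s * (q - s) - r = 0 ∧
          HasDerivAt (fun s => φ s + deriv φ s * (q - s) - r) (deriv (deriv φ) s * (q - s)) s ∧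
          deriv (deriv φ) s * (q - s) ≠ 0}).Countable :=
      (finite_compl_regularSet hf h0).countable.biUnion fun q _ =>
        (fib_finite hf q).countable.biUnion fun r _ =>
          countable_simple_zeros (fun s => φ s + deriv φ s * (q - s) - r)
            (fun s => deriv (deriv φ) s * (q - s))
    refine hc.mono ?_
    rintro s ⟨hs, q, hq, hne, hz⟩
    refine Set.mem_iUnion₂.2 ⟨q, hq, Set.mem_iUnion₂.2 ⟨_, hz, sub_self _, ?_,
      mul_ne_zero (hD s hs).2.2.2 (sub_ne_zero.2 hne)⟩⟩
    have := ((hφd hs).add ((hφdd hs).mul ((hasDerivAt_id s).const_sub q))).sub_const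
      (φ s + deriv φ s * (q - s))
    refine this.congr_deriv ?_
    simp
  have hb3 : {s ∈ D | s ≠ 0 ∧ φ s - deriv φ s * s = 0}.Countable := by
    refine (countable_simple_zeros (fun s => φ s - deriv φ s * s)
      (fun s => -(deriv (deriv φ) s * s))).mono ?_
    rintro s ⟨hs, hs0, hz⟩
    refine ⟨hz, ?_, neg_ne_zero.2 (mul_ne_zero (hD s hs).2.2.2 hs0)⟩
    refine ((hφd hs).sub ((hφdd hs).mul (hasDerivAt_id s))).congr_deriv ?_
    simp
  have hb4 : {s ∈ D | Q.eval (deriv φ s) = 0}.Countable := by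
    have hc : (⋃ w ∈ (Q.roots.toFinset : Set ℂ), {s | deriv φ s - w = 0 ∧
        HasDerivAt (fun s => deriv φ s - w) (deriv (deriv φ) s) s ∧
        deriv (deriv φ) s ≠ 0}).Countable :=
      (Finset.countable_toSet _).biUnion fun w _ =>
        countable_simple_zeros (fun s => deriv φ s - w) (deriv (deriv φ))
    refine hc.mono ?_
    rintro s ⟨hs, hz⟩
    exact Set.mem_iUnion₂.2 ⟨deriv φ s, by simp [hQ, hz], sub_self _, (hφdd hs).sub_const _,
      (hD s hs).2.2.2⟩
  obtain ⟨s, hs, hsb⟩ := (((hb1.union hb2).union (hb3.union hb4)).union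
    (Set.countable_singleton (0 : ℂ))).dense_compl ℂ |>.exists_mem_open hDo hDne
  obtain ⟨hφa, hhs, hfy, hφ2⟩ := hD s hsb
  simp only [Set.mem_compl_iff, Set.mem_union, not_or, Set.mem_ofPred_eq, Set.mem_singleton_iff,
    not_and, not_exists, hsb, true_and] at hs
  obtain ⟨⟨⟨h1, h2⟩, h3, h4⟩, hs0⟩ := hs
  have hline : ∀ q, φ s - deriv φ s * s + deriv φ s * q = φ s + deriv φ s * (q - s) := fun q => by
    ring
  have hlines : φ s - deriv φ s * s + deriv φ s * s = φ s := by ring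
  have htang : ∀ᶠ t in 𝓝 s, f.innerDerivative.evalEval t (φ t) +
      deriv φ t * f.derivative.evalEval t (φ t) = 0 := by
    filter_upwards [hDo.eventually_mem hsb, (hDo.eventually_mem hsb).eventually_nhds] with t h5 h6
    have h7 := f.hasDerivAt_evalEval_comp (hasDerivAt_id t) (hφd h5)
    have h8 : HasDerivAt (fun t => f.evalEval (id t) (φ t)) 0 t := by
      refine (hasDerivAt_const t (0 : ℂ)).congr_of_eventuallyEq (h6.mono fun q hq => ?_)
      change f.evalEval q (φ q) = 0
      rw [hdvd, evalEval_mul, (hD q hq).2.1, zero_mul]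
    have := h7.unique h8
    simp only [id, mul_one] at this
    linear_combination this
  refine ⟨s, φ s - deriv φ s * s, deriv φ s, h3 hs0, h4, by rwa [hlines], by rwa [hlines], ?_, ?_,
    ?_⟩
  · rw [eval_derivative_eval_affine, hlines]
    exact htang.self_of_nhds
  · rw [derivative_eval_affine, eval_derivative_eval_affine, hlines]
    intro hcon
    have h5 := (f.innerDerivative.hasDerivAt_evalEval_comp (hasDerivAt_id s) (hφd hsb)).add
      ((hφdd hsb).mul (f.derivative.hasDerivAt_evalEval_comp (hasDerivAt_id s) (hφd hsb)))
    have h6 := h5.unique ((hasDerivAt_const s (0 : ℂ)).congr_of_eventuallyEq htang)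
    have h7 := (f.innerDerivative + C (C (deriv φ s)) * f.derivative).hasDerivAt_evalEval_comp
      (hasDerivAt_id s) (hφd hsb)
    have h8 := (f.innerDerivative.hasDerivAt_evalEval_comp (hasDerivAt_id s) (hφd hsb)).add
      ((f.derivative.hasDerivAt_evalEval_comp (hasDerivAt_id s) (hφd hsb)).const_mul (deriv φ s))
    have h9 := h7.unique (h8.congr_of_eventuallyEq (Filter.Eventually.of_forall fun t => by
      simp [evalEval_add, evalEval_mul]))
    simp only [id] at h6 h9
    refine mul_ne_zero hφ2 hfy ?_
    linear_combination h6 + h9 - hcon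
  · intro q hq hz hd
    rw [evalEval_eval_affine, hline] at hz
    rw [eval_derivative_eval_affine, hline] at hd
    by_cases hqr : q ∈ f.regularSet
    · exact h1 q hqr hq hz hd
    · exact h2 q hqr hq hz

end Polynomial

namespace MvPolynomial

theorem IsHomogeneous.eval_smul {σ : Type*} {n : ℕ} {G : MvPolynomial σ ℂ} (hG : G.IsHomogeneous n)
    (c : ℂ) (v : σ → ℂ) : eval (c • v) G = c ^ n * eval v G := by
  rw [eval_eq, eval_eq, Finset.mul_sum]
  refine Finset.sum_congr rfl fun e he => ?_
  have hdeg : ∑ i ∈ e.support, e i = n := by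
    have := hG (mem_support_iff.1 he)
    rwa [Finsupp.weight_apply, Finsupp.sum, Finset.sum_congr rfl] at this
    simp
  simp only [Pi.smul_apply, smul_eq_mul, mul_pow, Finset.prod_mul_distrib,
    Finset.prod_pow_eq_pow_sum,
    hdeg]
  ring

theorem IsHomogeneous.sum_eq_of_mem_support {n : ℕ} {G : MvPolynomial (Fin 3) ℂ}
    (hG : G.IsHomogeneous n) {e : Fin 3 →₀ ℕ} (he : e ∈ G.support) : e 0 + e 1 + e 2 = n := by
  have := hG (mem_support_iff.1 he)
  rw [Finsupp.weight_apply, Finsupp.sum_fintype _ _ (by simp)] at this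
  simpa [Fin.sum_univ_three] using this

section Line

variable {R : Type*} [CommRing R] [Algebra ℂ R] {n : ℕ} {G : MvPolynomial (Fin 3) ℂ}

theorem coeff_aeval_line (G : MvPolynomial (Fin 3) ℂ) (l m : R) (j : ℕ) :
    (aeval ![Polynomial.C l, Polynomial.C m, Polynomial.X] G).coeff j =
      ∑ e ∈ G.support,
        if e 2 = j then algebraMap ℂ R (coeff e G) * l ^ e 0 * m ^ e 1 else 0 := by
  rw [aeval_def, eval₂_eq', Polynomial.finsetSum_coeff]
  refine Finset.sum_congr rfl fun e _ => ?_
  simp only [Fin.prod_univ_three, Matrix.cons_val_zero, Matrix.cons_val_one, Matrix.cons_val]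
  rw [Polynomial.algebraMap_apply, ← Polynomial.C_pow, ← Polynomial.C_pow, ← mul_assoc, ← mul_assoc,
    ← Polynomial.C_mul, ← Polynomial.C_mul, Polynomial.coeff_C_mul_X_pow]
  simp only [eq_comm]

theorem natDegree_aeval_line_le (hG : G.IsHomogeneous n) (l m : R) :
    (aeval ![Polynomial.C l, Polynomial.C m, Polynomial.X] G).natDegree ≤ n := by
  refine Polynomial.natDegree_le_iff_coeff_eq_zero.2 fun j hj => ?_
  rw [coeff_aeval_line]
  refine Finset.sum_eq_zero fun e he => if_neg ?_
  have := hG.sum_eq_of_mem_support he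
  omega

theorem coeff_aeval_line_top (hG : G.IsHomogeneous n) (l m : R) :
    (aeval ![Polynomial.C l, Polynomial.C m, Polynomial.X] G).coeff n =
      algebraMap ℂ R (eval ![0, 0, 1] G) := by
  rw [coeff_aeval_line, eval_eq', map_sum]
  refine Finset.sum_congr rfl fun e he => ?_
  have hs := hG.sum_eq_of_mem_support he
  simp only [Fin.prod_univ_three, Matrix.cons_val_zero, Matrix.cons_val_one, Matrix.cons_val,
    one_pow, mul_one]
  by_cases h : e 2 = n
  · rw [if_pos h, show e 0 = 0 by omega, show e 1 = 0 by omega]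
    simp
  · rw [if_neg h]
    rcases (by omega : e 0 ≠ 0 ∨ e 1 ≠ 0) with h0 | h0 <;> simp [h0]

theorem exists_coeff_aeval_line_pred (hn : 1 ≤ n) (hG : G.IsHomogeneous n) :
    ∃ α β : ℂ, ∀ l m : R, (aeval ![Polynomial.C l, Polynomial.C m, Polynomial.X] G).coeff (n - 1) =
      algebraMap ℂ R α * l + algebraMap ℂ R β * m := by
  refine ⟨∑ e ∈ G.support, if e 0 = 1 ∧ e 1 = 0 then coeff e G else 0,
    ∑ e ∈ G.support, if e 0 = 0 ∧ e 1 = 1 then coeff e G else 0, fun l m => ?_⟩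
  rw [coeff_aeval_line, map_sum, map_sum, Finset.sum_mul, Finset.sum_mul, ← Finset.sum_add_distrib]
  refine Finset.sum_congr rfl fun e he => ?_
  have hs := hG.sum_eq_of_mem_support he
  by_cases h : e 2 = n - 1
  · rw [if_pos h]
    rcases (by omega : (e 0 = 1 ∧ e 1 = 0) ∨ (e 0 = 0 ∧ e 1 = 1)) with ⟨h0, h1⟩ | ⟨h0, h1⟩ <;>
      simp [h0, h1]
  · rw [if_neg h, if_neg (by omega), if_neg (by omega)]
    simp

end Line

/-- The restriction of `F` to the pencil of lines through `o`, in the affine coordinate `t` of the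
pencil (the inner variable) and the affine coordinate `x` on its members (the outer variable). -/
def pencil (F : MvPolynomial (Fin 3) ℂ) (a b o : Fin 3 → ℂ) : Polynomial (Polynomial ℂ) :=
  aeval (fun i => Polynomial.C (Polynomial.C (a i) + Polynomial.C (b i) * Polynomial.X) +
    Polynomial.C (Polynomial.C (o i)) * Polynomial.X) F

theorem evalEval_pencil (F : MvPolynomial (Fin 3) ℂ) (a b o : Fin 3 → ℂ) (t x : ℂ) :
    (F.pencil a b o).evalEval t x = eval (a + t • b + x • o) F := by
  have h : (Polynomial.evalEvalRingHom t x).comp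
      (algebraMap ℂ (Polynomial (Polynomial ℂ))) = RingHom.id ℂ := by
    ext z
    simp [Polynomial.algebraMap_apply]
  rw [pencil, ← Polynomial.coe_evalEvalRingHom, map_aeval, h]
  rw [coe_eval₂Hom, eval, coe_eval₂Hom]
  congr 1
  funext i
  simp only [Polynomial.coe_evalEvalRingHom, Polynomial.evalEval_add,
    Polynomial.evalEval_mul, Polynomial.evalEval_C, Polynomial.evalEval_X, Polynomial.eval_add,
    Polynomial.eval_mul, Polynomial.eval_C, Polynomial.eval_X, Pi.add_apply, Pi.smul_apply,
    smul_eq_mul]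
  ring

theorem pencil_mul (F G : MvPolynomial (Fin 3) ℂ) (a b o : Fin 3 → ℂ) :
    (F * G).pencil a b o = F.pencil a b o * G.pencil a b o :=
  map_mul _ _ _

theorem pencil_pow (F : MvPolynomial (Fin 3) ℂ) (m : ℕ) (a b o : Fin 3 → ℂ) :
    (F ^ m).pencil a b o = F.pencil a b o ^ m :=
  map_pow _ _ _

theorem pencil_add (F G : MvPolynomial (Fin 3) ℂ) (a b o : Fin 3 → ℂ) :
    (F + G).pencil a b o = F.pencil a b o + G.pencil a b o :=
  map_add _ _ _

theorem pencil_sub (F G : MvPolynomial (Fin 3) ℂ) (a b o : Fin 3 → ℂ) :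
    (F - G).pencil a b o = F.pencil a b o - G.pencil a b o :=
  map_sub _ _ _

theorem pencil_C (c : ℂ) (a b o : Fin 3 → ℂ) :
    (C c : MvPolynomial (Fin 3) ℂ).pencil a b o = Polynomial.C (Polynomial.C c) :=
  algHom_C _ _

theorem pencil_add_smul (F : MvPolynomial (Fin 3) ℂ) (a b o : Fin 3 → ℂ) (κ : ℂ) :
    F.pencil a (b + κ • a) o = aeval ![Polynomial.C (1 + Polynomial.C κ * Polynomial.X),
      Polynomial.C Polynomial.X, (Polynomial.X : Polynomial (Polynomial ℂ))]
      (bind₁ (fun i => C (a i) * X 0 + C (b i) * X 1 + C (o i) * X 2 :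
        Fin 3 → MvPolynomial (Fin 3) ℂ) F) := by
  rw [aeval_bind₁, pencil]
  congr 2
  funext i
  simp [algHom_C, Polynomial.algebraMap_apply]
  ring

theorem IsHomogeneous.bind₁_linear {F : MvPolynomial (Fin 3) ℂ} {n : ℕ} (hF : F.IsHomogeneous n)
    (a b o : Fin 3 → ℂ) : (bind₁ (fun i => C (a i) * X 0 + C (b i) * X 1 + C (o i) * X 2 :
        Fin 3 → MvPolynomial (Fin 3) ℂ) F).IsHomogeneous n := by
  rw [← one_mul n]
  refine hF.aeval _ fun i => ?_
  have h (c : ℂ) (j : Fin 3) : (C c * X j : MvPolynomial (Fin 3) ℂ).IsHomogeneous 1 := by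
    simpa using (isHomogeneous_C (Fin 3) c).mul (isHomogeneous_X ℂ j)
  exact ((h _ _).add (h _ _)).add (h _ _)

variable {F : MvPolynomial (Fin 3) ℂ} {n : ℕ}

theorem natDegree_pencil_le (hF : F.IsHomogeneous n) (a b o : Fin 3 → ℂ) :
    (F.pencil a b o).natDegree ≤ n := by
  have := F.pencil_add_smul a b o 0
  rw [zero_smul, add_zero] at this
  rw [this]
  exact natDegree_aeval_line_le (R := Polynomial ℂ) (hF.bind₁_linear a b o) _ _

theorem coeff_pencil (hF : F.IsHomogeneous n) (a b o : Fin 3 → ℂ) :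
    (F.pencil a b o).coeff n = Polynomial.C (eval o F) := by
  have := F.pencil_add_smul a b o 0
  rw [zero_smul, add_zero] at this
  rw [this, coeff_aeval_line_top (hF.bind₁_linear a b o), ← coe_aeval_eq_eval]
  simp only [RingHom.coe_coe]
  rw [aeval_bind₁]
  change Polynomial.C _ = _
  rw [← coe_aeval_eq_eval, RingHom.coe_coe]
  congr 3
  funext i
  simp

/-- In suitable coordinates on a pencil whose centre lies on the curve, the coefficient of the
pencil that becomes leading is constant. -/
theorem exists_coeff_pencil_pred_eq_C (hn : 1 ≤ n) (hF : F.IsHomogeneous n) {a b o : Fin 3 → ℂ}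
    (h : ((F.pencil a b o).coeff (n - 1)).eval 0 ≠ 0) :
    ∃ κ α : ℂ, α ≠ 0 ∧ (F.pencil a (b + κ • a) o).coeff (n - 1) = Polynomial.C α := by
  obtain ⟨α, β, hαβ⟩ := exists_coeff_aeval_line_pred (R := Polynomial ℂ) hn
    (hF.bind₁_linear a b o)
  have h0 := F.pencil_add_smul a b o 0
  rw [zero_smul, add_zero] at h0
  rw [h0, hαβ] at h
  have hα : α ≠ 0 := by simpa using h
  refine ⟨-β / α, α, hα, ?_⟩
  rw [F.pencil_add_smul, hαβ, Polynomial.algebraMap_eq, mul_add, mul_one, ← mul_assoc,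
    ← Polynomial.C_mul, mul_div_cancel₀ _ hα, Polynomial.C_neg]
  ring

end MvPolynomial

/-- The linear forms `w 0, w 1, w 2` are the coordinates of the basis `v 0, v 1, v 2` of `ℂ³`. -/
structure IsDualFrame (v w : Fin 3 → Fin 3 → ℂ) : Prop where
  dual : ∀ j k, w j ⬝ᵥ v k = if j = k then 1 else 0

namespace IsDualFrame

variable {v w : Fin 3 → Fin 3 → ℂ}

theorem expand (h : IsDualFrame v w) (x : Fin 3 → ℂ) :
    x = (w 0 ⬝ᵥ x) • v 0 + (w 1 ⬝ᵥ x) • v 1 + (w 2 ⬝ᵥ x) • v 2 := by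
  have h1 : Matrix.of w * (Matrix.of v).transpose = 1 := by
    ext j k
    rw [Matrix.mul_apply', Matrix.one_apply]
    exact h.dual j k
  have h2 := congrArg (fun M => M.mulVec x) (mul_eq_one_comm.1 h1)
  simp only [Matrix.one_mulVec, ← Matrix.mulVec_mulVec] at h2
  conv_lhs => rw [← h2]
  funext i
  simp only [Matrix.mulVec, dotProduct, Fin.sum_univ_three, Matrix.transpose_apply, Matrix.of_apply,
    Pi.add_apply, Pi.smul_apply, smul_eq_mul]
  ring

theorem of_eqs {a b o p q r : Fin 3 → ℂ} (h : p ⬝ᵥ a = 1 ∧ p ⬝ᵥ b = 0 ∧ p ⬝ᵥ o = 0)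
    (h' : q ⬝ᵥ a = 0 ∧ q ⬝ᵥ b = 1 ∧ q ⬝ᵥ o = 0) (h'' : r ⬝ᵥ a = 0 ∧ r ⬝ᵥ b = 0 ∧ r ⬝ᵥ o = 1) :
    IsDualFrame ![a, b, o] ![p, q, r] := by
  refine ⟨fun j k => ?_⟩
  fin_cases j <;> fin_cases k <;> simp [h, h', h'']

theorem exists_dotProduct_eq_one {ξ : Fin 3 → ℂ} (hξ : ξ ≠ 0) : ∃ b, ξ ⬝ᵥ b = 1 := by
  obtain ⟨i, hi⟩ := Function.ne_iff.1 hξ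
  exact ⟨Pi.single i (ξ i)⁻¹, by rw [dotProduct_single]; exact mul_inv_cancel₀ hi⟩

theorem exists_of_dotProduct_eq_zero {ξ o : Fin 3 → ℂ} (hξ : ξ ≠ 0) (ho : o ≠ 0)
    (h : ξ ⬝ᵥ o = 0) : ∃ v w, IsDualFrame v w ∧ w 1 = ξ ∧ v 2 = o := by
  obtain ⟨b, hb⟩ := exists_dotProduct_eq_one hξ
  have hbo : crossProduct b o ≠ 0 := by
    intro h0
    have h1 := cross_cross_eq_smul_sub_smul' ξ b o
    rw [h0, dotProduct_comm b, hb, h] at h1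
    simp at h1
    exact ho h1
  obtain ⟨a, ha⟩ := exists_dotProduct_eq_one hbo
  have hbb : crossProduct b o ⬝ᵥ b = 0 := by
    rw [dotProduct_comm]; exact dot_self_cross b o
  have hbo' : crossProduct b o ⬝ᵥ o = 0 := by
    rw [dotProduct_comm]; exact dot_cross_self b o
  have ha' : crossProduct b o ⬝ᵥ (a - (ξ ⬝ᵥ a) • b) = 1 := by
    rw [dotProduct_sub, dotProduct_smul, ha, hbb]; simp
  set a' := a - (ξ ⬝ᵥ a) • b with hadef
  refine ⟨![a', b, o], ![crossProduct b o, ξ, crossProduct a' b],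
    of_eqs ⟨ha', hbb, hbo'⟩ ⟨?_, hb, h⟩ ⟨?_, ?_, ?_⟩, rfl, rfl⟩
  · rw [hadef, dotProduct_sub, dotProduct_smul, hb]; simp
  · rw [dotProduct_comm]; exact dot_self_cross a' b
  · rw [dotProduct_comm]; exact dot_cross_self a' b
  · rw [dotProduct_comm, triple_product_permutation, dotProduct_comm, ha']

/-- Changing the affine coordinate on the pencil of lines through `v 2` so that the line at infinity
moves. -/
theorem shear (h : IsDualFrame v w) (κ : ℂ) :
    IsDualFrame ![v 0, v 1 + κ • v 0, v 2] ![w 0 - κ • w 1, w 1, w 2] := by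
  refine of_eqs ⟨?_, ?_, ?_⟩ ⟨?_, ?_, ?_⟩ ⟨?_, ?_, ?_⟩ <;>
    simp [sub_dotProduct, dotProduct_add, h.dual]

end IsDualFrame

namespace MvPolynomial

/-- The linear form with coefficient vector `w`. -/
def linearForm (w : Fin 3 → ℂ) : MvPolynomial (Fin 3) ℂ := ∑ i, C (w i) * X i

theorem isHomogeneous_linearForm (w : Fin 3 → ℂ) : (linearForm w).IsHomogeneous 1 :=
  IsHomogeneous.sum _ _ _ fun i _ => by
    simpa using (isHomogeneous_C (Fin 3) (w i)).mul (isHomogeneous_X ℂ i)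

theorem eval_linearForm (w x : Fin 3 → ℂ) : eval x (linearForm w) = w ⬝ᵥ x := by
  simp [linearForm, dotProduct]

theorem pencil_linearForm (w a b o : Fin 3 → ℂ) : (linearForm w).pencil a b o =
    Polynomial.C (Polynomial.C (w ⬝ᵥ a) + Polynomial.C (w ⬝ᵥ b) * Polynomial.X) +
    Polynomial.C (Polynomial.C (w ⬝ᵥ o)) * Polynomial.X := by
  simp [linearForm, pencil, dotProduct, Fin.sum_univ_three, Polynomial.algebraMap_apply]
  ring

variable {v w : Fin 3 → Fin 3 → ℂ} (h : IsDualFrame v w)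
include h

theorem exists_pencil_eq (p : Polynomial (Polynomial ℂ)) :
    ∃ n, ∃ P : MvPolynomial (Fin 3) ℂ, P.IsHomogeneous n ∧ P.pencil (v 0) (v 1) (v 2) = p := by
  have h0 : (linearForm (w 0)).pencil (v 0) (v 1) (v 2) = 1 := by
    simp [pencil_linearForm, h.dual]
  have h1 : (linearForm (w 1)).pencil (v 0) (v 1) (v 2) = Polynomial.C Polynomial.X := by
    simp [pencil_linearForm, h.dual]
  have h2 : (linearForm (w 2)).pencil (v 0) (v 1) (v 2) = Polynomial.X := by
    simp [pencil_linearForm, h.dual]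
  have hadd : ∀ p q : Polynomial (Polynomial ℂ),
      (∃ n, ∃ P : MvPolynomial (Fin 3) ℂ, P.IsHomogeneous n ∧ P.pencil (v 0) (v 1) (v 2) = p) →
      (∃ n, ∃ P : MvPolynomial (Fin 3) ℂ, P.IsHomogeneous n ∧ P.pencil (v 0) (v 1) (v 2) = q) →
      ∃ n, ∃ P : MvPolynomial (Fin 3) ℂ, P.IsHomogeneous n ∧
        P.pencil (v 0) (v 1) (v 2) = p + q := by
    rintro p q ⟨n, P, hP, rfl⟩ ⟨m, Q, hQ, rfl⟩
    refine ⟨n + m, linearForm (w 0) ^ m * P + linearForm (w 0) ^ n * Q, ?_, ?_⟩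
    · refine .add ?_ ?_
      · simpa [add_comm] using ((isHomogeneous_linearForm (w 0)).pow m).mul hP
      · simpa using ((isHomogeneous_linearForm (w 0)).pow n).mul hQ
    · simp only [pencil_add, pencil_mul, pencil_pow, h0, one_pow, one_mul]
  induction p using Polynomial.induction_on' with
  | add p q hp hq => exact hadd p q hp hq
  | monomial j c =>
    induction c using Polynomial.induction_on' with
    | add p q hp hq =>
      rw [map_add]
      exact hadd _ _ hp hq
    | monomial i c =>
      refine ⟨i + j, C c * linearForm (w 1) ^ i * linearForm (w 2) ^ j, ?_, ?_⟩
      · simpa using ((isHomogeneous_C (Fin 3) c).mul ((isHomogeneous_linearForm (w 1)).pow i)).mul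
          ((isHomogeneous_linearForm (w 2)).pow j)
      · simp only [pencil_mul, pencil_pow, pencil_C, h1, h2, ← Polynomial.C_mul_X_pow_eq_monomial,
          Polynomial.C_mul, Polynomial.C_pow]

theorem eval_eq_of_dualFrame {n : ℕ} {P : MvPolynomial (Fin 3) ℂ} (hP : P.IsHomogeneous n)
    {x : Fin 3 → ℂ} (hx : w 0 ⬝ᵥ x ≠ 0) : eval x P = (w 0 ⬝ᵥ x) ^ n *
      (P.pencil (v 0) (v 1) (v 2)).evalEval ((w 1 ⬝ᵥ x) / (w 0 ⬝ᵥ x))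
        ((w 2 ⬝ᵥ x) / (w 0 ⬝ᵥ x)) := by
  rw [evalEval_pencil, ← hP.eval_smul]
  congr 1
  conv_lhs => rw [h.expand x]
  simp only [smul_add, smul_smul, mul_div_cancel₀ _ hx]

theorem eq_zero_of_pencil_eq_zero {n : ℕ} {P : MvPolynomial (Fin 3) ℂ} (hP : P.IsHomogeneous n)
    (hp : P.pencil (v 0) (v 1) (v 2) = 0) : P = 0 := by
  have : linearForm (w 0) * P = 0 := by
    refine MvPolynomial.funext fun x => ?_
    rw [map_mul, eval_linearForm, map_zero]
    by_cases hx : w 0 ⬝ᵥ x = 0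
    · rw [hx, zero_mul]
    · rw [eval_eq_of_dualFrame h hP hx, hp]
      simp
  refine (mul_eq_zero.1 this).resolve_left fun h0 => ?_
  have := eval_linearForm (w 0) (v 0)
  rw [h0, h.dual] at this
  simp at this

theorem irreducible_pencil {n : ℕ} {F : MvPolynomial (Fin 3) ℂ} (hF : F.IsHomogeneous n)
    (hn : 2 ≤ n) (hirr : Irreducible F) : Irreducible (F.pencil (v 0) (v 1) (v 2)) := by
  have h0 : (linearForm (w 0)).pencil (v 0) (v 1) (v 2) = 1 := by
    simp [pencil_linearForm, h.dual]
  have hprime : Prime F := irreducible_iff_prime.1 hirr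
  have hne : linearForm (w 0) ≠ 0 := by
    intro h0
    have := eval_linearForm (w 0) (v 0)
    rw [h0, h.dual] at this
    simp at this
  have hFl (m : ℕ) : ¬ F ∣ linearForm (w 0) ^ m := by
    intro hd
    have hd := hprime.dvd_of_dvd_pow hd
    have := totalDegree_le_of_dvd_of_isDomain hd hne
    rw [hF.totalDegree hirr.ne_zero, (isHomogeneous_linearForm (w 0)).totalDegree hne] at this
    omega
  have key (p q : Polynomial (Polynomial ℂ)) (hpq : F.pencil (v 0) (v 1) (v 2) = p * q) :
      ∃ P Q : MvPolynomial (Fin 3) ℂ, ∃ k m : ℕ, P.pencil (v 0) (v 1) (v 2) = p ∧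
        Q.pencil (v 0) (v 1) (v 2) = q ∧
        linearForm (w 0) ^ k * F = linearForm (w 0) ^ m * (P * Q) := by
    obtain ⟨i, P, hP, rfl⟩ := exists_pencil_eq h p
    obtain ⟨j, Q, hQ, rfl⟩ := exists_pencil_eq h q
    refine ⟨P, Q, i + j, n, rfl, rfl, ?_⟩
    rw [← sub_eq_zero]
    have h1 := ((isHomogeneous_linearForm (w 0)).pow (i + j)).mul hF
    have h2 := ((isHomogeneous_linearForm (w 0)).pow n).mul (hP.mul hQ)
    rw [one_mul] at h1 h2
    rw [add_comm n] at h2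
    refine eq_zero_of_pencil_eq_zero h (h1.sub h2) ?_
    simp only [pencil_sub, pencil_mul, pencil_pow, h0, hpq, one_pow, one_mul, sub_self]
  have hunit {p q : Polynomial (Polynomial ℂ)} {P : MvPolynomial (Fin 3) ℂ}
      (hpq : F.pencil (v 0) (v 1) (v 2) = p * q)
      (hP : P.pencil (v 0) (v 1) (v 2) = p) (hd : F ∣ P) : IsUnit q := by
    obtain ⟨G, rfl⟩ := hd
    rw [pencil_mul] at hP
    have hF0 : F.pencil (v 0) (v 1) (v 2) ≠ 0 := fun h0 =>
      hirr.ne_zero (eq_zero_of_pencil_eq_zero h hF h0)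
    refine .of_mul_eq_one_right (G.pencil (v 0) (v 1) (v 2)) (mul_left_cancel₀ hF0 ?_)
    rw [← mul_assoc, hP, ← hpq, mul_one]
  refine ⟨fun hu => ?_, fun p q hpq => ?_⟩
  · obtain ⟨u, hu⟩ := hu.exists_right_inv
    obtain ⟨k, U, hU, rfl⟩ := exists_pencil_eq h u
    refine hFl (n + k) ⟨U, ?_⟩
    rw [← sub_eq_zero]
    have h1 := (isHomogeneous_linearForm (w 0)).pow (n + k)
    rw [one_mul] at h1
    refine eq_zero_of_pencil_eq_zero h (h1.sub (hF.mul hU)) ?_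
    simp only [pencil_sub, pencil_mul, pencil_pow, h0, hu, one_pow, sub_self]
  · obtain ⟨P, Q, k, m, hP, hQ, hPQ⟩ := key p q hpq
    rcases hprime.dvd_or_dvd ((hprime.dvd_or_dvd (hPQ ▸ dvd_mul_left F _)).resolve_left (hFl m))
      with hd | hd
    · exact .inr (hunit hpq hP hd)
    · exact .inl (hunit (by rw [hpq, mul_comm]) hQ hd)

end MvPolynomial

namespace P2

theorem continuous_mk {Y : Type*} [TopologicalSpace Y] {g : Y → Fin 3 → ℂ} (hg : Continuous g)
    (h0 : ∀ y, g y ≠ 0) : Continuous fun y => (Projectivization.mk ℂ (g y) (h0 y) : P2) :=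
  (continuous_quotient_mk' (s := projectivizationSetoid ℂ (Fin 3 → ℂ))).comp
    (hg.subtype_mk h0)

theorem mk_mem_lineSet {ξ y : Fin 3 → ℂ} (hξ : ξ ≠ 0) (hy : y ≠ 0) :
    Projectivization.mk ℂ y hy ∈ lineSet (Projectivization.mk ℂ ξ hξ) ↔ ξ ⬝ᵥ y = 0 := by
  obtain ⟨a, ha⟩ := Projectivization.exists_smul_eq_mk_rep ℂ ξ hξ
  obtain ⟨c, hc⟩ := Projectivization.exists_smul_eq_mk_rep ℂ y hy
  change (Projectivization.mk ℂ ξ hξ).rep ⬝ᵥ (Projectivization.mk ℂ y hy).rep = 0 ↔ _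
  rw [← ha, ← hc, Units.smul_def, Units.smul_def, smul_dotProduct, dotProduct_smul]
  simp

theorem mk_mem_curveSet {F : MvPolynomial (Fin 3) ℂ} {n : ℕ} (hF : F.IsHomogeneous n)
    {y : Fin 3 → ℂ} (hy : y ≠ 0) : Projectivization.mk ℂ y hy ∈ curveSet F ↔ eval y F = 0 := by
  obtain ⟨c, hc⟩ := Projectivization.exists_smul_eq_mk_rep ℂ y hy
  change eval (Projectivization.mk ℂ y hy).rep F = 0 ↔ _
  rw [← hc, Units.smul_def, hF.eval_smul]
  simp

theorem mk_eq_mk_of_smul {y z : Fin 3 → ℂ} (hy : y ≠ 0) (hz : z ≠ 0) {c : ℂ} (h : c • z = y) :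
    Projectivization.mk ℂ y hy = Projectivization.mk ℂ z hz :=
  (Projectivization.mk_eq_mk_iff' ℂ y z hy hz).2 ⟨c, h⟩

end P2

namespace IsDualFrame

variable {v w : Fin 3 → Fin 3 → ℂ} (h : IsDualFrame v w)
include h

theorem line_ne_zero (t : ℂ) : w 1 - t • w 0 ≠ 0 := fun h0 => by
  have := congrArg (· ⬝ᵥ v 1) h0
  simp [sub_dotProduct, h.dual] at this

theorem point_ne_zero (p : ℂ × ℂ) : v 0 + p.1 • v 1 + p.2 • v 2 ≠ 0 := fun h0 => by
  have := congrArg (w 0 ⬝ᵥ ·) h0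
  simp [dotProduct_add, h.dual] at this

theorem center_ne_zero : v 2 ≠ 0 := fun h0 => by
  have := congrArg (w 2 ⬝ᵥ ·) h0
  simp [h.dual] at this

/-- The line with parameter `t` in the pencil of lines through `v 2`. -/
def line (t : ℂ) : P2 := Projectivization.mk ℂ _ (h.line_ne_zero t)

/-- The point with affine coordinate `p.2` on the line with parameter `p.1`. -/
def point (p : ℂ × ℂ) : P2 := Projectivization.mk ℂ _ (h.point_ne_zero p)

/-- The centre of the pencil. -/
def center : P2 := Projectivization.mk ℂ _ h.center_ne_zero

theorem continuous_line : Continuous h.line :=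
  P2.continuous_mk (by fun_prop) _

theorem continuous_point : Continuous h.point :=
  P2.continuous_mk (by fun_prop) _

theorem center_mem_lineSet (t : ℂ) : h.center ∈ lineSet (h.line t) := by
  rw [center, line, P2.mk_mem_lineSet]
  simp [sub_dotProduct, h.dual]

theorem point_mem_lineSet (t x : ℂ) : h.point (t, x) ∈ lineSet (h.line t) := by
  rw [point, line, P2.mk_mem_lineSet]
  simp [sub_dotProduct, dotProduct_add, h.dual]

theorem point_ne_center (p : ℂ × ℂ) : h.point p ≠ h.center := fun he => by
  obtain ⟨c, hc⟩ := (Projectivization.mk_eq_mk_iff' ℂ _ _ _ _).1 he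
  have := congrArg (w 0 ⬝ᵥ ·) hc
  simp [dotProduct_add, h.dual] at this

theorem injective_point (t : ℂ) : Function.Injective fun x => h.point (t, x) := fun x y he => by
  obtain ⟨c, hc⟩ := (Projectivization.mk_eq_mk_iff' ℂ _ _ _ _).1 he
  have h0 := congrArg (w 0 ⬝ᵥ ·) hc
  have h2 := congrArg (w 2 ⬝ᵥ ·) hc
  simp [dotProduct_add, h.dual] at h0 h2
  simpa [h0] using h2.symm

theorem exists_eq_point {t : ℂ} {q : P2} (hq : q ∈ lineSet (h.line t)) (hqc : q ≠ h.center) :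
    ∃ x, q = h.point (t, x) := by
  induction q using Projectivization.ind with | _ y hy
  rw [line, P2.mk_mem_lineSet, sub_dotProduct, smul_dotProduct, smul_eq_mul, sub_eq_zero] at hq
  have hy' := h.expand y
  rw [hq] at hy'
  by_cases h0 : w 0 ⬝ᵥ y = 0
  · rw [h0] at hy'
    refine absurd (P2.mk_eq_mk_of_smul _ _ (c := w 2 ⬝ᵥ y) ?_) hqc
    conv_rhs => rw [hy']
    simp
  · refine ⟨(w 2 ⬝ᵥ y) / (w 0 ⬝ᵥ y), P2.mk_eq_mk_of_smul _ _ (c := w 0 ⬝ᵥ y) ?_⟩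
    conv_rhs => rw [hy']
    simp only [smul_add, smul_smul, mul_div_cancel₀ _ h0, mul_comm t]

variable {F : MvPolynomial (Fin 3) ℂ} {n : ℕ} (hF : F.IsHomogeneous n)
include hF

theorem point_mem_curveSet {t x : ℂ} : h.point (t, x) ∈ curveSet F ↔
    (F.pencil (v 0) (v 1) (v 2)).evalEval t x = 0 := by
  rw [point, P2.mk_mem_curveSet hF, evalEval_pencil]

theorem center_mem_curveSet : h.center ∈ curveSet F ↔ eval (v 2) F = 0 := by
  rw [center, P2.mk_mem_curveSet hF]

theorem curveSet_inter_lineSet (t : ℂ) : curveSet F ∩ lineSet (h.line t) =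
    (fun x => h.point (t, x)) '' (F.pencil (v 0) (v 1) (v 2)).fib t ∪ curveSet F ∩ {h.center} := by
  ext q
  constructor
  · rintro ⟨hq, hql⟩
    by_cases hqc : q = h.center
    · exact .inr ⟨hq, hqc⟩
    · obtain ⟨x, rfl⟩ := h.exists_eq_point hql hqc
      exact .inl ⟨x, (h.point_mem_curveSet hF).1 hq, rfl⟩
  · rintro (⟨x, hx, rfl⟩ | ⟨hq, rfl⟩)
    · exact ⟨(h.point_mem_curveSet hF).2 hx, h.point_mem_lineSet t x⟩
    · exact ⟨hq, h.center_mem_lineSet t⟩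

theorem finite_fib {t : ℂ} (ht : (curveSet F ∩ lineSet (h.line t)).Finite) :
    ((F.pencil (v 0) (v 1) (v 2)).fib t).Finite := by
  rw [h.curveSet_inter_lineSet hF] at ht
  exact .of_finite_image (ht.subset Set.subset_union_left) (h.injective_point t).injOn

theorem ncard_curveSet_inter_lineSet {t : ℂ} (hfin : ((F.pencil (v 0) (v 1) (v 2)).fib t).Finite) :
    (curveSet F ∩ lineSet (h.line t)).ncard =
      ((F.pencil (v 0) (v 1) (v 2)).fib t).ncard + (curveSet F ∩ {h.center}).ncard := by
  rw [h.curveSet_inter_lineSet hF, Set.ncard_union_eq _ (hfin.image _)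
    ((Set.finite_singleton _).subset Set.inter_subset_right),
    Set.ncard_image_of_injective _ (h.injective_point t)]
  rw [Set.disjoint_left]
  rintro _ ⟨x, -, rfl⟩ ⟨-, hx⟩
  exact h.point_ne_center _ hx

end IsDualFrame

namespace Polynomial

theorem coeff_ne_zero_of_ncard_eq {p : Polynomial ℂ} {n : ℕ} (hle : p.natDegree ≤ n)
    (hfin : {x | p.eval x = 0}.Finite) (hcard : {x | p.eval x = 0}.ncard = n) :
    p.coeff n ≠ 0 := by
  have hp : p ≠ 0 := by
    rintro rfl
    simp at hfin
    exact Set.infinite_univ hfin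
  have hroots : {x | p.eval x = 0} = (p.roots.toFinset : Set ℂ) := by
    ext x
    simp [hp]
  rw [hroots, Set.ncard_coe_finset] at hcard
  have : n ≤ p.natDegree := hcard ▸ (Multiset.toFinset_card_le _).trans p.card_roots'
  rw [le_antisymm this hle]
  exact leadingCoeff_ne_zero.2 hp

theorem exists_monic_of_coeff_eq_C {p : Polynomial (Polynomial ℂ)} {m : ℕ} {α : ℂ} (hα : α ≠ 0)
    (hle : p.natDegree ≤ m) (hc : p.coeff m = C α) :
    ∃ H : Polynomial (Polynomial ℂ), H.Monic ∧ H.natDegree = m ∧ p = C (C α) * H := by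
  have hmul : C α * C α⁻¹ = (1 : Polynomial ℂ) := by
    rw [← C_mul, mul_inv_cancel₀ hα, C_1]
  have hc' : (C (C α⁻¹) * p).coeff m = 1 := by
    rw [coeff_C_mul, hc, mul_comm, hmul]
  have hle' : (C (C α⁻¹) * p).natDegree ≤ m := (natDegree_C_mul_le _ _).trans hle
  refine ⟨C (C α⁻¹) * p, monic_of_natDegree_le_of_coeff_eq_one m hle' hc', ?_, ?_⟩
  · exact le_antisymm hle' (le_natDegree_of_ne_zero (by rw [hc']; exact one_ne_zero))
  · rw [← mul_assoc, ← C_mul, hmul, C_1, one_mul]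

theorem fib_C_mul {κ : ℂ} (hκ : κ ≠ 0) (H : Polynomial (Polynomial ℂ)) (t : ℂ) :
    (C (C κ) * H).fib t = H.fib t := by
  ext x
  simp [mem_fib, hκ]

theorem mem_regularSet_of_ncard_fib {H : Polynomial (Polynomial ℂ)} (hH : H.Monic) {t : ℂ}
    (hcard : (H.fib t).ncard = H.natDegree) : t ∈ H.regularSet := by
  intro x hx hx'
  rw [fib_eq_roots hH, Set.ncard_coe_finset, ← card_roots_map hH t] at hcard
  have hnd := Multiset.dedup_card_eq_card_iff_nodup.1 hcard
  have h1 := Multiset.nodup_iff_count_le_one.1 hnd x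
  rw [count_roots] at h1
  have := (one_lt_rootMultiplicity_iff_isRoot (hH.map_evalRingHom_ne_zero t)).2
    ⟨by rwa [IsRoot, map_evalRingHom_eval], by rwa [derivative_map, IsRoot, map_evalRingHom_eval]⟩
  omega

end Polynomial

namespace IsDualFrame

variable {v w : Fin 3 → Fin 3 → ℂ} (h : IsDualFrame v w) {F : MvPolynomial (Fin 3) ℂ} {d : ℕ}
  (hF : F.IsHomogeneous d) {κ : ℂ} (hκ : κ ≠ 0) {H : Polynomial (Polynomial ℂ)} (hH : H.Monic)
  (hHF : F.pencil (v 0) (v 1) (v 2) = Polynomial.C (Polynomial.C κ) * H)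
  (hdeg : H.natDegree + (curveSet F ∩ {h.center}).ncard = d)
include hF hκ hH hHF hdeg

theorem line_mem_transversalLines {t : ℂ} :
    h.line t ∈ transversalLines F d ↔ t ∈ H.regularSet := by
  have hfib := Polynomial.fib_C_mul hκ H t
  rw [transversalLines, Set.mem_ofPred_eq, h.ncard_curveSet_inter_lineSet hF, hHF, hfib, ← hdeg,
    add_left_inj]
  · exact ⟨Polynomial.mem_regularSet_of_ncard_fib hH, Polynomial.ncard_fib hH⟩
  · rw [hHF, hfib]
    exact Polynomial.fib_finite hH t

/-- Monodromy of the affine fibration cut out by a pencil of lines is monodromy of the family of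
transversal line sections. -/
theorem monodromy {t t' : ℂ} {σ : ℂ → ℂ} (hσ : Monodromy H.fib H.regularSet t t' σ) {σ' : P2 → P2}
    (hσ' : ∀ x, H.evalEval t x = 0 → σ' (h.point (t, x)) = h.point (t', σ x))
    (hc : h.center ∈ curveSet F → σ' h.center = h.center) :
    Monodromy (fun ξ => curveSet F ∩ lineSet ξ) (transversalLines F d) (h.line t) (h.line t')
      σ' := by
  refine hσ.map h.continuous_line h.continuous_point (K := curveSet F ∩ {h.center})
    (fun s hs => (h.line_mem_transversalLines hF hκ hH hHF hdeg).2 hs) (fun s _ => ?_)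
    (fun s _ => (h.injective_point s).injOn) ?_ hσ' ?_
  · rw [h.curveSet_inter_lineSet hF, hHF, Polynomial.fib_C_mul hκ]
  · rintro s - x - ⟨-, hx⟩
    exact h.point_ne_center _ hx
  · rintro k ⟨hk, rfl⟩
    exact hc hk

end IsDualFrame

namespace IsDualFrame

variable {F : MvPolynomial (Fin 3) ℂ} {d : ℕ}

theorem exists_monic_of_eval_ne_zero {v w : Fin 3 → Fin 3 → ℂ} (h : IsDualFrame v w)
    (hF : F.IsHomogeneous d) (hF2 : eval (v 2) F ≠ 0) :
    ∃ H : Polynomial (Polynomial ℂ), H.Monic ∧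
      F.pencil (v 0) (v 1) (v 2) = Polynomial.C (Polynomial.C (eval (v 2) F)) * H ∧
      H.natDegree + (curveSet F ∩ {h.center}).ncard = d := by
  obtain ⟨H, hH, hdeg, hHF⟩ := Polynomial.exists_monic_of_coeff_eq_C hF2
    (natDegree_pencil_le hF (v 0) (v 1) (v 2)) (coeff_pencil hF (v 0) (v 1) (v 2))
  refine ⟨H, hH, hHF, ?_⟩
  have : curveSet F ∩ {h.center} = ∅ := by
    rw [Set.inter_singleton_eq_empty, h.center_mem_curveSet hF]
    exact hF2
  rw [this, Set.ncard_empty, hdeg, add_zero]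

/-- Around a transversal line, coordinates can be chosen on the pencil of lines through one of its
points so that the affine parts of the line sections form the fibres of a monic polynomial. -/
theorem exists_monic (hd : 1 ≤ d) (hF : F.IsHomogeneous d) {ξ o : Fin 3 → ℂ} (hξ : ξ ≠ 0)
    (ho : o ≠ 0) (hξo : ξ ⬝ᵥ o = 0) (hT : Projectivization.mk ℂ ξ hξ ∈ transversalLines F d) :
    ∃ v w, ∃ h : IsDualFrame v w, v 2 = o ∧ w 1 = ξ ∧ ∃ κ ≠ 0,
      ∃ H : Polynomial (Polynomial ℂ), H.Monic ∧
        F.pencil (v 0) (v 1) (v 2) = Polynomial.C (Polynomial.C κ) * H ∧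
        H.natDegree + (curveSet F ∩ {h.center}).ncard = d := by
  obtain ⟨v, w, h, rfl, rfl⟩ := exists_of_dotProduct_eq_zero hξ ho hξo
  by_cases hF2 : eval (v 2) F = 0
  · have hline : h.line 0 = Projectivization.mk ℂ (w 1) hξ := by simp [line]
    rw [← hline, transversalLines, Set.mem_ofPred_eq] at hT
    have hfin : ((F.pencil (v 0) (v 1) (v 2)).fib 0).Finite :=
      h.finite_fib hF (Set.finite_of_ncard_ne_zero (by omega))
    have hc : curveSet F ∩ {h.center} = {h.center} := by
      rw [Set.inter_eq_right, Set.singleton_subset_iff, h.center_mem_curveSet hF]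
      exact hF2
    rw [h.ncard_curveSet_inter_lineSet hF hfin, hc, Set.ncard_singleton] at hT
    have hle (b : Fin 3 → ℂ) : (F.pencil (v 0) b (v 2)).natDegree ≤ d - 1 := by
      refine Polynomial.natDegree_le_iff_coeff_eq_zero.2 fun j hj => ?_
      rcases (by omega : j = d ∨ d < j) with rfl | hj
      · rw [coeff_pencil hF, hF2, Polynomial.C_0]
      · exact Polynomial.natDegree_le_iff_coeff_eq_zero.1 (natDegree_pencil_le hF _ _ _) j hj
    have hcoeff : ((F.pencil (v 0) (v 1) (v 2)).coeff (d - 1)).eval 0 ≠ 0 := by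
      have hset : {x | ((F.pencil (v 0) (v 1) (v 2)).map (Polynomial.evalRingHom 0)).eval x = 0} =
          (F.pencil (v 0) (v 1) (v 2)).fib 0 := by
        ext x
        rw [Set.mem_ofPred_eq, Polynomial.map_evalRingHom_eval, Polynomial.mem_fib]
      have := Polynomial.coeff_ne_zero_of_ncard_eq
        (Polynomial.natDegree_map_le.trans (hle _)) (hset ▸ hfin) (by rw [hset]; omega)
      rwa [Polynomial.coeff_map] at this
    obtain ⟨μ, α, hα, hμ⟩ := exists_coeff_pencil_pred_eq_C hd hF hcoeff
    obtain ⟨H, hH, hdeg, hHF⟩ := Polynomial.exists_monic_of_coeff_eq_C hα (hle _) hμ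
    refine ⟨_, _, h.shear μ, rfl, rfl, α, hα, H, hH, hHF, ?_⟩
    change _ + (curveSet F ∩ {h.center}).ncard = _
    rw [hc, Set.ncard_singleton]
    omega
  · obtain ⟨H, hH⟩ := h.exists_monic_of_eval_ne_zero hF hF2
    exact ⟨v, w, h, rfl, rfl, _, hF2, H, hH⟩

end IsDualFrame

namespace IsDualFrame

variable {v w : Fin 3 → Fin 3 → ℂ} (h : IsDualFrame v w)
include h

theorem line_zero {ξ : Fin 3 → ℂ} (hξ : ξ ≠ 0) {c : ℂ} (hw : c • ξ = w 1) :
    h.line 0 = Projectivization.mk ℂ ξ hξ :=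
  P2.mk_eq_mk_of_smul _ _ (by rw [hw, zero_smul, sub_zero])

theorem exists_eq_point_of_mem_curveSet {G : MvPolynomial (Fin 3) ℂ} {m : ℕ}
    (hG : G.IsHomogeneous m)
    {t : ℂ} {q : P2} (hq : q ∈ curveSet G ∩ lineSet (h.line t)) (hqc : q ≠ h.center) :
    ∃ x, (G.pencil (v 0) (v 1) (v 2)).evalEval t x = 0 ∧ q = h.point (t, x) := by
  obtain ⟨x, rfl⟩ := h.exists_eq_point hq.2 hqc
  exact ⟨x, (h.point_mem_curveSet hG).1 hq.1, rfl⟩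

end IsDualFrame

theorem MvPolynomial.pencil_dvd {F G : MvPolynomial (Fin 3) ℂ} (hGF : G ∣ F) {a b o : Fin 3 → ℂ}
    {κ : ℂ} (hκ : κ ≠ 0) {H : Polynomial (Polynomial ℂ)}
    (hHF : F.pencil a b o = Polynomial.C (Polynomial.C κ) * H) : G.pencil a b o ∣ H := by
  have hu : IsUnit (Polynomial.C (Polynomial.C κ)) :=
    ((isUnit_iff_ne_zero.2 hκ).map Polynomial.C).map Polynomial.C
  obtain ⟨G', rfl⟩ := hGF
  rw [pencil_mul] at hHF
  exact hu.dvd_mul_left.1 ⟨_, hHF.symm⟩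

section

variable {F G : MvPolynomial (Fin 3) ℂ} {d m : ℕ} (hd : 1 ≤ d) (hF : F.IsHomogeneous d)
  (hG : G.IsHomogeneous m) (hm : 2 ≤ m) (hirr : Irreducible G) (hGF : G ∣ F)
  {l₀ : P2} (hl₀ : l₀ ∈ transversalLines F d)
include hd hF hG hm hirr hGF hl₀

/-- The stabilizer of a point of a transversal line section acts transitively on the remaining
points of an irreducible component. -/
theorem exists_monodromy_fixing {P q q' : P2} (hP : P ∈ lineSet l₀)
    (hq : q ∈ curveSet G ∩ lineSet l₀) (hq' : q' ∈ curveSet G ∩ lineSet l₀) (hqP : q ≠ P)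
    (hqP' : q' ≠ P) :
    ∃ σ, Monodromy (fun ξ => curveSet F ∩ lineSet ξ) (transversalLines F d) l₀ l₀ σ ∧
      σ P = P ∧ σ q = q' := by
  induction l₀ using Projectivization.ind with | _ ξ hξ
  induction P using Projectivization.ind with | _ o ho
  obtain ⟨v, w, h, rfl, rfl, κ, hκ, H, hH, hHF, hdeg⟩ :=
    IsDualFrame.exists_monic hd hF hξ ho ((P2.mk_mem_lineSet hξ ho).1 hP) hl₀
  have hline := h.line_zero hξ (one_smul ℂ _)
  have hcenter : Projectivization.mk ℂ (v 2) ho = h.center := rfl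
  rw [← hline] at hl₀ hq hq' ⊢
  rw [hcenter] at *
  obtain ⟨x, hx, rfl⟩ := h.exists_eq_point_of_mem_curveSet hG hq hqP
  obtain ⟨x', hx', rfl⟩ := h.exists_eq_point_of_mem_curveSet hG hq' hqP'
  obtain ⟨σ, hσ, rfl⟩ := Monodromy.exists_of_irreducible hH
    ((h.line_mem_transversalLines hF hκ hH hHF hdeg).1 hl₀) (irreducible_pencil h hG hm hirr)
    (pencil_dvd hGF hκ hHF) hx hx'
  have hinj := h.injective_point 0
  refine ⟨Function.extend (fun x => h.point (0, x)) (fun x => h.point (0, σ x)) id,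
    h.monodromy hF hκ hH hHF hdeg hσ (fun x _ => hinj.extend_apply _ _ x) fun _ => ?_, ?_,
    hinj.extend_apply _ _ x⟩
  all_goals
    rw [Function.extend_apply']
    · rfl
    · rintro ⟨x, hx⟩
      exact h.point_ne_center _ hx

end

namespace Polynomial

variable {f H : Polynomial (Polynomial ℂ)} {μ c s r : ℂ} {d : ℕ}

theorem map_evalRingHom_eq_comp (hc : c ≠ 0)
    (hrel : ∀ t x : ℂ, t ≠ 0 → H.evalEval t x = μ * t ^ d * f.evalEval (x / t) ((1 + x * r) / t)) :
    H.map (evalRingHom c⁻¹) = C (μ * c⁻¹ ^ d) * (f.eval (C c + C r * X)).comp (C c * X) := by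
  refine Polynomial.funext fun x => ?_
  rw [map_evalRingHom_eval, hrel _ _ (inv_ne_zero hc), eval_mul, eval_C, eval_comp,
    evalEval_eval_affine]
  simp only [eval_mul, eval_C, eval_X, div_inv_eq_mul]
  ring_nf

theorem derivative_map_evalRingHom (hc : c ≠ 0)
    (hrel : ∀ t x : ℂ, t ≠ 0 → H.evalEval t x = μ * t ^ d * f.evalEval (x / t) ((1 + x * r) / t)) :
    H.derivative.map (evalRingHom c⁻¹) =
      C (μ * c⁻¹ ^ d * c) * (f.eval (C c + C r * X)).derivative.comp (C c * X) := by
  rw [← derivative_map, map_evalRingHom_eq_comp hc hrel]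
  simp [derivative_comp]
  ring

theorem derivative_derivative_map_evalRingHom (hc : c ≠ 0)
    (hrel : ∀ t x : ℂ, t ≠ 0 → H.evalEval t x = μ * t ^ d * f.evalEval (x / t) ((1 + x * r) / t)) :
    H.derivative.derivative.map (evalRingHom c⁻¹) =
      C (μ * c⁻¹ ^ d * c * c) * (f.eval (C c + C r * X)).derivative.derivative.comp (C c * X) := by
  rw [← derivative_map, derivative_map_evalRingHom hc hrel]
  simp [derivative_comp]
  ring

theorem innerDerivative_evalEval_ne_zero (hc : c ≠ 0) (hμ : μ ≠ 0)
    (hrel : ∀ t x : ℂ, t ≠ 0 → H.evalEval t x = μ * t ^ d * f.evalEval (x / t) ((1 + x * r) / t))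
    (h0 : f.evalEval s (c + r * s) = 0) (h1 : f.derivative.evalEval s (c + r * s) ≠ 0)
    (hP : (f.eval (C c + C r * X)).derivative.eval s = 0) :
    H.innerDerivative.evalEval c⁻¹ (s / c) ≠ 0 := by
  have ht : c⁻¹ ≠ 0 := inv_ne_zero hc
  have hy0 : s / c / c⁻¹ = s := by field_simp
  have hx0 : (1 + s / c * r) / c⁻¹ = c + r * s := by field_simp
  have hy : HasDerivAt (fun t : ℂ => s / c / t) (-(s * c)) c⁻¹ := by
    refine ((hasDerivAt_inv ht).const_mul (s / c)).congr_deriv ?_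
    field_simp
  have hx : HasDerivAt (fun t : ℂ => (1 + s / c * r) / t) (-((c + s * r) * c)) c⁻¹ := by
    refine ((hasDerivAt_inv ht).const_mul (1 + s / c * r)).congr_deriv ?_
    field_simp
  have hcomp : HasDerivAt (fun t : ℂ => f.evalEval (s / c / t) ((1 + s / c * r) / t))
      (-(c ^ 2 * f.derivative.evalEval s (c + r * s))) c⁻¹ := by
    rw [eval_derivative_eval_affine] at hP
    convert hasDerivAt_evalEval_comp f hy hx using 1
    rw [hy0, hx0, eq_neg_of_add_eq_zero_left hP]
    ring
  have hpow : HasDerivAt (fun t : ℂ => μ * t ^ d) (μ * (d * c⁻¹ ^ (d - 1))) c⁻¹ :=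
    (hasDerivAt_pow d c⁻¹).const_mul μ
  have hprod := hpow.mul hcomp
  have hev : (fun t => H.evalEval t (s / c)) =ᶠ[𝓝 c⁻¹]
      (fun t : ℂ => μ * t ^ d) * fun t : ℂ => f.evalEval (s / c / t) ((1 + s / c * r) / t) := by
    filter_upwards [isOpen_ne.mem_nhds ht] with t ht
    exact hrel t _ ht
  rw [(hasDerivAt_evalEval_left H c⁻¹ (s / c)).unique (hprod.congr_of_eventuallyEq hev), hy0, hx0,
    h0, mul_zero, zero_add]
  exact mul_ne_zero (mul_ne_zero hμ (pow_ne_zero _ ht))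
    (neg_ne_zero.2 (mul_ne_zero (pow_ne_zero _ hc) h1))

end Polynomial

theorem exists_dotProduct_eq_zero (ξ : Fin 3 → ℂ) : ∃ o : Fin 3 → ℂ, o ≠ 0 ∧ ξ ⬝ᵥ o = 0 := by
  by_cases h0 : ξ 0 = 0
  · exact ⟨![1, 0, 0], fun h => by simpa using congrFun h 0, by
      simp [dotProduct, Fin.sum_univ_three, h0]⟩
  · exact ⟨![ξ 1, -ξ 0, 0], fun h => h0 (by simpa using congrFun h 1), by
      simp [dotProduct, Fin.sum_univ_three]; ring⟩

theorem exists_mem_line_eval_ne_zero {F : MvPolynomial (Fin 3) ℂ} {d : ℕ} (hF : F.IsHomogeneous d)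
    {ξ : Fin 3 → ℂ} (hξ : ξ ≠ 0)
    (hfin : (curveSet F ∩ lineSet (Projectivization.mk ℂ ξ hξ)).Finite) :
    ∃ o : Fin 3 → ℂ, o ≠ 0 ∧ ξ ⬝ᵥ o = 0 ∧ eval o F ≠ 0 := by
  obtain ⟨o, ho, hξo⟩ := exists_dotProduct_eq_zero ξ
  obtain ⟨v, w, h, rfl, rfl⟩ := IsDualFrame.exists_of_dotProduct_eq_zero hξ ho hξo
  rw [← h.line_zero hξ (one_smul ℂ _)] at hfin
  obtain ⟨x, hx⟩ :=
    (Set.infinite_range_of_injective (h.injective_point 0)).exists_notMem_finite hfin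
  obtain ⟨⟨x, rfl⟩, hx⟩ := hx
  refine ⟨_, h.point_ne_zero (0, x), ?_, fun h0 => hx ⟨?_, h.point_mem_lineSet 0 x⟩⟩
  · simp [dotProduct_add, h.dual]
  · exact (P2.mk_mem_curveSet hF _).2 h0

namespace IsDualFrame

variable {v w : Fin 3 → Fin 3 → ℂ} (h : IsDualFrame v w)
include h

/-- The coordinates obtained by moving the centre of a pencil along the line with parameter `0`,
which stays the line with parameter `0`. -/
theorem recenter {t : ℂ} (ht : t ≠ 0) (r : ℂ) :
    IsDualFrame ![v 2, v 0 + t • v 1, v 0 + r • v 2]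
      ![w 2 - r • (w 0 - t⁻¹ • w 1), t⁻¹ • w 1, w 0 - t⁻¹ • w 1] := by
  refine of_eqs ⟨?_, ?_, ?_⟩ ⟨?_, ?_, ?_⟩ ⟨?_, ?_, ?_⟩ <;>
    simp [sub_dotProduct, dotProduct_add, h.dual, ht, mul_left_comm t r]

/-- The coordinates on a pencil for which the line with parameter `0` moves to infinity. -/
theorem toInfinity {t : ℂ} (ht : t ≠ 0) :
    IsDualFrame ![v 0 + t • v 1, v 0, v 2] ![t⁻¹ • w 1, w 0 - t⁻¹ • w 1, w 2] := by
  refine of_eqs ⟨?_, ?_, ?_⟩ ⟨?_, ?_, ?_⟩ ⟨?_, ?_, ?_⟩ <;>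
    simp [sub_dotProduct, dotProduct_add, h.dual, ht]

theorem line_toInfinity {t : ℂ} (ht : t ≠ 0) : (h.toInfinity ht).line 0 = h.line t := by
  refine P2.mk_eq_mk_of_smul _ _ (c := -t⁻¹) ?_
  simp only [Matrix.cons_val_one, Matrix.cons_val_zero, smul_sub, smul_smul]
  rw [neg_mul, inv_mul_cancel₀ ht]
  module

end IsDualFrame

section

variable {F G : MvPolynomial (Fin 3) ℂ} {d m : ℕ} (hd : 1 ≤ d) (hF : F.IsHomogeneous d)
  (hG : G.IsHomogeneous m) (hm : 2 ≤ m) (hirr : Irreducible G) (hGF : G ∣ F)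
  {l₀ : P2} (hl₀ : l₀ ∈ transversalLines F d)
include hd hF hG hm hirr hGF hl₀

/-- A simple tangent line of an irreducible component produces a transposition of two points of that
component. -/
theorem exists_monodromy_swap [DecidableEq P2] :
    ∃ x ∈ curveSet G ∩ lineSet l₀, ∃ y ∈ curveSet G ∩ lineSet l₀, x ≠ y ∧
    Monodromy (fun ξ => curveSet F ∩ lineSet ξ) (transversalLines F d) l₀ l₀ (Equiv.swap x y) := by
  induction l₀ using Projectivization.ind with | _ ξ hξ
  have hfin : (curveSet F ∩ lineSet (Projectivization.mk ℂ ξ hξ)).Finite :=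
    Set.finite_of_ncard_ne_zero (by rw [hl₀]; omega)
  obtain ⟨o, ho, hξo, hFo⟩ := exists_mem_line_eval_ne_zero hF hξ hfin
  obtain ⟨v, w, h, rfl, rfl⟩ := IsDualFrame.exists_of_dotProduct_eq_zero hξ ho hξo
  obtain ⟨H, hH, hHF, hdeg⟩ := h.exists_monic_of_eval_ne_zero hF hFo
  have hl₁ := hl₀
  rw [← h.line_zero hξ (one_smul ℂ _), h.line_mem_transversalLines hF hFo hH hHF hdeg] at hl₁
  obtain ⟨t, ht, ht0⟩ : ∃ t ∈ H.regularSet, t ≠ 0 := by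
    obtain ⟨t, ht⟩ := ((Polynomial.finite_compl_regularSet hH hl₁).union
      (Set.finite_singleton 0)).infinite_compl.nonempty
    rw [Set.mem_compl_iff, Set.mem_union, not_or, Set.notMem_compl_iff] at ht
    exact ⟨t, ht⟩
  have hf' := h.toInfinity ht0
  obtain ⟨f, hf, hfF, hfdeg⟩ := hf'.exists_monic_of_eval_ne_zero hF hFo
  have hf0 : 0 ∈ f.regularSet := by
    rw [← hf'.line_mem_transversalLines hF hFo hf hfF hfdeg, h.line_toInfinity ht0,
      h.line_mem_transversalLines hF hFo hH hHF hdeg]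
    exact ht
  obtain ⟨g, hg⟩ := pencil_dvd hGF hFo hfF
  have hGo : eval (v 2) G ≠ 0 := fun h0 => hFo (by
    obtain ⟨G', rfl⟩ := hGF
    rw [map_mul, h0, zero_mul])
  have hGdeg : 2 ≤ (G.pencil (v 0 + t • v 1) (v 0) (v 2)).natDegree := by
    refine hm.trans (Polynomial.le_natDegree_of_ne_zero ?_)
    rw [coeff_pencil hG]
    exact Polynomial.C_ne_zero.2 hGo
  obtain ⟨Q, hQ, hQe⟩ : ∃ Q : Polynomial ℂ, Q ≠ 0 ∧ ∀ r, Q.eval r = eval (v 0 + r • v 2) F := by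
    refine ⟨(F.pencil (v 0) 0 (v 2)).map (Polynomial.evalRingHom 0), fun h0 => ?_, fun r => ?_⟩
    · have := congrArg (Polynomial.coeff · d) h0
      simp [coeff_pencil hF, hFo] at this
    · rw [Polynomial.map_evalRingHom_eval, evalEval_pencil]
      simp
  obtain ⟨s, c, r, hc, hQr, hGs, hfs, hP1, hP2, hPq⟩ :=
    Polynomial.exists_simple_tangent hf (irreducible_pencil hf' hG hm hirr) hg hGdeg hf0 hQ
  rw [hQe] at hQr
  have hk := h.recenter ht0 r
  obtain ⟨K, hK, hKF, hKdeg⟩ := hk.exists_monic_of_eval_ne_zero hF hQr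
  have hcomb (t' x : ℂ) (ht' : t' ≠ 0) : v 2 + t' • (v 0 + t • v 1) + x • (v 0 + r • v 2) =
      t' • (v 0 + t • v 1 + (x / t') • v 0 + ((1 + x * r) / t') • v 2) := by
    simp only [smul_add, smul_smul, mul_div_cancel₀ _ ht', add_smul, one_smul]
    module
  have hrel (t' x : ℂ) (ht' : t' ≠ 0) : K.evalEval t' x =
      (eval (v 2) F / eval (v 0 + r • v 2) F) * t' ^ d *
        f.evalEval (x / t') ((1 + x * r) / t') := by
    have h1 := congrArg (Polynomial.evalEval t' x) hKF
    have h2 := congrArg (Polynomial.evalEval (x / t') ((1 + x * r) / t')) hfF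
    rw [evalEval_pencil] at h1 h2
    simp only [Matrix.cons_val_zero, Matrix.cons_val_one, Matrix.cons_val,
      Polynomial.evalEval_mul, Polynomial.evalEval_C, Polynomial.eval_C] at h1 h2
    rw [hcomb t' x ht', hF.eval_smul, h2] at h1
    field_simp
    rw [mul_comm, ← h1]
    ring
  have hμ : eval (v 2) F / eval (v 0 + r • v 2) F ≠ 0 := div_ne_zero hFo hQr
  obtain ⟨g', hg'⟩ := pencil_dvd hGF hQr hKF
  have hD0 (q : ℂ) := congrArg (Polynomial.eval q) (Polynomial.map_evalRingHom_eq_comp hc hrel)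
  have hD1 (q : ℂ) := congrArg (Polynomial.eval q) (Polynomial.derivative_map_evalRingHom hc hrel)
  have hD2 (q : ℂ) := congrArg (Polynomial.eval q)
    (Polynomial.derivative_derivative_map_evalRingHom hc hrel)
  simp only [Polynomial.map_evalRingHom_eval, Polynomial.eval_mul, Polynomial.eval_C,
    Polynomial.eval_comp, Polynomial.eval_X] at hD0 hD1 hD2
  have hcs : c * (s / c) = s := mul_div_cancel₀ _ hc
  have hcd : c⁻¹ ^ d ≠ 0 := pow_ne_zero _ (inv_ne_zero hc)
  have hK0 : 0 ∈ K.regularSet := by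
    rw [← hk.line_mem_transversalLines hF hQr hK hKF hKdeg, hk.line_zero hξ rfl]
    exact hl₀
  obtain ⟨x, x', hxx', hx, hx', hswap⟩ := Monodromy.exists_swap hK hg' hK0 (t₁ := c⁻¹) (x₁ := s / c)
    (by
      rw [evalEval_pencil] at hGs ⊢
      simp only [Matrix.cons_val_zero, Matrix.cons_val_one, Matrix.cons_val] at hGs ⊢
      rw [hcomb _ _ (inv_ne_zero hc), hG.eval_smul]
      convert mul_zero (c⁻¹ ^ m) using 2
      convert hGs using 4
      · field_simp
      · field_simp)
    (by rw [hD1, hcs, hP1, mul_zero])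
    (by
      rw [hD2, hcs]
      exact mul_ne_zero (mul_ne_zero (mul_ne_zero (mul_ne_zero hμ hcd) hc) hc) hP2)
    (Polynomial.innerDerivative_evalEval_ne_zero hc hμ hrel
      (by rw [hg, Polynomial.evalEval_mul, hGs, zero_mul]) hfs hP1)
    (fun q hq hqs => by
      rw [hD0] at hq
      rw [hD1]
      refine mul_ne_zero (mul_ne_zero (mul_ne_zero hμ hcd) hc) (hPq _ (fun hcq => hqs ?_)
        ((mul_eq_zero.1 hq).resolve_left (mul_ne_zero hμ hcd)))
      rw [← hcq, mul_div_cancel_left₀ _ hc])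
  rw [← hk.line_zero hξ rfl]
  have hinj := hk.injective_point 0
  refine ⟨hk.point (0, x), ⟨(hk.point_mem_curveSet hG).2 hx, hk.point_mem_lineSet _ _⟩,
    hk.point (0, x'), ⟨(hk.point_mem_curveSet hG).2 hx', hk.point_mem_lineSet _ _⟩, hinj.ne hxx',
    hk.monodromy hF hQr hK hKF hKdeg hswap (fun y _ => (hinj.swap_apply x x' y)) fun _ => ?_⟩
  exact Equiv.swap_apply_of_ne_of_ne (hk.point_ne_center _).symm (hk.point_ne_center _).symm

end

theorem curveSet_subset_of_dvd {F G : MvPolynomial (Fin 3) ℂ} (h : G ∣ F) :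
    curveSet G ⊆ curveSet F := by
  obtain ⟨G', rfl⟩ := h
  intro x (hx : eval _ G = 0)
  change eval _ _ = 0
  rw [map_mul, hx, zero_mul]

/-- **Theorem 1 of the paper, monodromy form.**  Let
`C = C₁ ∪ … ∪ C_k = {F₁ ⋯ F_k = 0}` be a reduced plane curve of degree `d ≥ 1`, with the
`F_i` pairwise non-proportional irreducible homogeneous polynomials of degrees
`d_i ≥ 2`.  Let `l₀ ∈ T_C` and let `τ` be any permutation of the `d`-element set
`C ∩ l₀` mapping `C_i ∩ l₀` onto itself for every `i`.  Then there is a loop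
`γ : [0,1] → T_C` based at `l₀` and, for each `P ∈ C ∩ l₀`, a continuous path
`ψ P : [0,1] → ℙ²` starting at `P` with `ψ P t ∈ C ∩ γ t` for all `t`, such that at each
time `t` the points `ψ P t`, `P ∈ C ∩ l₀`, are pairwise distinct and `ψ P 1 = τ P` for
every `P ∈ C ∩ l₀`; i.e. the monodromy group of the family of transversal line sections
of `C` is the direct product `Σ_{d₁} × … × Σ_{d_k}` of the symmetric groups on the sets
`C_i ∩ l₀`. -/
theorem exists_loop_realizing_component_preserving_permutation
    (k : ℕ) (Fs : Fin k → MvPolynomial (Fin 3) ℂ) (ds : Fin k → ℕ)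
    (F : MvPolynomial (Fin 3) ℂ) (d : ℕ) (hd : 1 ≤ d)
    (hFprod : F = ∏ i, Fs i)
    (hirr : ∀ i, Irreducible (Fs i))
    (hprop : ∀ i j, i ≠ j → ¬ Associated (Fs i) (Fs j))
    (hhom : ∀ i, (Fs i).IsHomogeneous (ds i))
    (hds : ∀ i, 2 ≤ ds i)
    (hF : F.IsHomogeneous d)
    (l₀ : P2) (hl₀ : l₀ ∈ transversalLines F d)
    (τ : P2 → P2)
    (hbij : Set.BijOn τ (curveSet F ∩ lineSet l₀) (curveSet F ∩ lineSet l₀))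
    (hcomp : ∀ i, ∀ P ∈ curveSet (Fs i) ∩ lineSet l₀, τ P ∈ curveSet (Fs i)) :
    ∃ γ : unitInterval → P2, Continuous γ ∧ (∀ t, γ t ∈ transversalLines F d) ∧
      γ 0 = l₀ ∧ γ 1 = l₀ ∧
      ∃ ψ : P2 → unitInterval → P2,
        (∀ P ∈ curveSet F ∩ lineSet l₀, Continuous (ψ P) ∧ ψ P 0 = P ∧
          ∀ t, ψ P t ∈ curveSet F ∩ lineSet (γ t)) ∧
        (∀ t : unitInterval, ∀ P ∈ curveSet F ∩ lineSet l₀, ∀ Q ∈ curveSet F ∩ lineSet l₀,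
          ψ P t = ψ Q t → P = Q) ∧
        ∀ P ∈ curveSet F ∩ lineSet l₀, ψ P 1 = τ P := by
  classical
  have hfin : (curveSet F ∩ lineSet l₀).Finite :=
    Set.finite_of_ncard_ne_zero (by rw [hl₀]; omega)
  have hdvd (i : Fin k) : Fs i ∣ F := hFprod ▸ Finset.dvd_prod_of_mem Fs (Finset.mem_univ i)
  have hsub (i : Fin k) : curveSet (Fs i) ∩ lineSet l₀ ⊆ curveSet F ∩ lineSet l₀ :=
    Set.inter_subset_inter_left _ (curveSet_subset_of_dvd (hdvd i))
  have hmonodromy : Monodromy (fun ξ => curveSet F ∩ lineSet ξ) (transversalLines F d) l₀ l₀ τ := by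
    refine Monodromy.of_swaps (S := fun ξ => curveSet F ∩ lineSet ξ) hl₀ hfin
      (fun P => {i | P ∈ curveSet (Fs i)}) ?_ hbij ?_
    · intro x hx y hy hxy hcol
      have hx0 : eval x.rep F = 0 := hx.1
      rw [hFprod, map_prod] at hx0
      obtain ⟨i, -, hi⟩ := Finset.prod_eq_zero_iff.1 hx0
      have hxi : x ∈ curveSet (Fs i) := hi
      have hyi : y ∈ curveSet (Fs i) := (Set.ext_iff.1 hcol i).1 hxi
      refine Monodromy.swap_of_stabilizers (S := fun ξ => curveSet F ∩ lineSet ξ)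
        (W := curveSet (Fs i) ∩ lineSet l₀) hfin (hsub i) ?_ ?_ ⟨hxi, hx.2⟩ ⟨hyi, hy.2⟩ hxy
      · exact fun p hp q hq q' hq' hqp hqp' =>
          exists_monodromy_fixing hd hF (hhom i) (hds i) (hirr i)
          (hdvd i) hl₀ hp.2 hq hq' hqp hqp'
      · exact exists_monodromy_swap hd hF (hhom i) (hds i) (hirr i) (hdvd i) hl₀
    · intro x hx
      ext i
      refine ⟨fun hi => ?_, fun hi => hcomp i x ⟨hi, hx.2⟩⟩
      have himage : τ '' (curveSet (Fs i) ∩ lineSet l₀) = curveSet (Fs i) ∩ lineSet l₀ := by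
        refine Set.eq_of_subset_of_ncard_le ?_ ?_ (hfin.subset (hsub i))
        · rintro _ ⟨y, hy, rfl⟩
          exact ⟨hcomp i y hy, (hbij.mapsTo (hsub i hy)).2⟩
        · rw [(hbij.injOn.mono (hsub i)).ncard_image]
      obtain ⟨y, hy, hyx⟩ := himage.ge ⟨hi, (hbij.mapsTo hx).2⟩
      rw [← hbij.injOn (hsub i hy) hx hyx]
      exact hy.1
  obtain ⟨γ, hγ, ψ, hψ, hinj⟩ := hmonodromy
  exact ⟨γ, γ.continuous, hγ, γ.source, γ.target, ψ,
    fun P hP => ⟨(hψ P hP).1, (hψ P hP).2.1, (hψ P hP).2.2.2⟩,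
    fun t P hP Q hQ hPQ => hinj t hP hQ hPQ, fun P hP => (hψ P hP).2.2.1⟩

end
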